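/- arXiv:2209.11257 — 2 statements merged into one kernel-verified Lean document; each statement's English description precedes it below -/
import Mathlib

section
/- Let p be an odd prime and let r₁, r₂, q₁, q₂ be units in ℤ/p. Suppose there exists z ∈ ℤ/p with r₁ r₂ z² = q₁ q₂ or r₁ r₂ z² = −q₁ q₂ (that is, ±(r₁r₂)/(q₁q₂) is a quadratic residue mod p). Then the product space L(p;r₁) × L(p;r₂) is homotopy equivalent to L(p;q₁) × L(p;q₂). -/
/-- The unit sphere `S³ = {(z₁,z₂) ∈ ℂ² : |z₁|² + |z₂|² = 1}`, with the subspace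
topology. -/
abbrev Sphere3 : Type := {z : ℂ × ℂ // ‖z.1‖ ^ 2 + ‖z.2‖ ^ 2 = 1}

/-- Two points of `S³` are related when some `k ∈ ℤ/p` carries one to the other
under the action `(z₁, z₂) ↦ (e^{2πik/p} z₁, e^{2πikr/p} z₂)`. -/
def lensRel (p : ℕ) (r : ZMod p) (x y : Sphere3) : Prop :=
  ∃ k : ZMod p,
    (y : ℂ × ℂ) =
      (Complex.exp (2 * Real.pi * Complex.I * ((k.val : ℕ) : ℂ) / p) * (x : ℂ × ℂ).1,
       Complex.exp (2 * Real.pi * Complex.I * (((k * r).val : ℕ) : ℂ) / p) * (x : ℂ × ℂ).2)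

/-- The lens space `L(p;r)`: the quotient of `S³` by the `ℤ/p` action with rotation
numbers `1, r`, with the quotient topology. -/
abbrev Lens (p : ℕ) (r : ZMod p) : Type := Quot (lensRel p r)

section parta
open ComplexConjugate

namespace LensProof

theorem sphere_norm_aux (u v u' v' : ℂ) :
    ‖u * u' - conj v * v'‖ ^ 2 + ‖v * u' + conj u * v'‖ ^ 2
      = (‖u‖ ^ 2 + ‖v‖ ^ 2) * (‖u'‖ ^ 2 + ‖v'‖ ^ 2) := by
  simp only [Complex.sq_norm, Complex.normSq_apply]
  simp
  ring

noncomputable instance : Mul Sphere3 :=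
  ⟨fun x y => ⟨(x.1.1 * y.1.1 - conj x.1.2 * y.1.2, x.1.2 * y.1.1 + conj x.1.1 * y.1.2), by
    have := sphere_norm_aux x.1.1 x.1.2 y.1.1 y.1.2
    rw [x.2, y.2] at this
    simpa using this⟩⟩

noncomputable instance : One Sphere3 := ⟨⟨(1, 0), by simp⟩⟩

noncomputable instance : Inv Sphere3 :=
  ⟨fun x => ⟨(conj x.1.1, - x.1.2), by simpa using x.2⟩⟩

theorem mul_val (x y : Sphere3) : (x * y).1 =
  (x.1.1 * y.1.1 - conj x.1.2 * y.1.2, x.1.2 * y.1.1 + conj x.1.1 * y.1.2) := rfl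
theorem one_val : (1 : Sphere3).1 = (1, 0) := rfl
theorem inv_val (x : Sphere3) : (x⁻¹).1 = (conj x.1.1, - x.1.2) := rfl

theorem sphere_conj (x : Sphere3) : conj x.1.1 * x.1.1 + conj x.1.2 * x.1.2 = 1 := by
  have := x.2
  rw [mul_comm, Complex.mul_conj, mul_comm, Complex.mul_conj, ← Complex.sq_norm, ← Complex.sq_norm]
  exact_mod_cast this

noncomputable instance : Group Sphere3 := Group.ofLeftAxioms
  (by
    intro x y z
    apply Subtype.ext
    apply Prod.ext
    · simp [mul_val]; ring
    · simp [mul_val]; ring)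
  (by
    intro x
    apply Subtype.ext
    simp [mul_val, one_val])
  (by
    intro x
    apply Subtype.ext
    apply Prod.ext
    · simp only [mul_val, inv_val, one_val]
      simp [sphere_conj x]
    · simp only [mul_val, inv_val, one_val]
      simp; ring)

instance : IsTopologicalGroup Sphere3 where
  continuous_mul := by
    refine Continuous.subtype_mk ?_ _
    have h : Continuous (fun a : ℂ => conj a) := Complex.continuous_conj
    fun_prop
  continuous_inv := by
    refine Continuous.subtype_mk ?_ _
    have h : Continuous (fun a : ℂ => conj a) := Complex.continuous_conj
    fun_prop

instance : CompactSpace Sphere3 := by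
  refine isCompact_iff_compactSpace (s := {z : ℂ × ℂ | ‖z.1‖ ^ 2 + ‖z.2‖ ^ 2 = 1}).1 ?_
  refine Metric.isCompact_of_isClosed_isBounded ?_ ?_
  · exact isClosed_eq (by fun_prop) (by fun_prop)
  · refine (Metric.isBounded_closedBall (x := (0 : ℂ × ℂ)) (r := 1)).subset ?_
    rintro ⟨a, b⟩ h
    simp only [Set.mem_ofPred_eq] at h
    simp only [mem_closedBall_zero_iff, Prod.norm_def, sup_le_iff]
    constructor <;> nlinarith [norm_nonneg a, norm_nonneg b]

/-- Normalised pair. -/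
noncomputable def nz (C D : ℂ) (h : ¬ (C = 0 ∧ D = 0)) : Sphere3 :=
  ⟨(C / (Real.sqrt (‖C‖ ^ 2 + ‖D‖ ^ 2) : ℝ), D / (Real.sqrt (‖C‖ ^ 2 + ‖D‖ ^ 2) : ℝ)), by
    have h0 : 0 < ‖C‖ ^ 2 + ‖D‖ ^ 2 := by
      rcases not_and_or.1 h with h | h
      · have := norm_pos_iff.2 h
        positivity
      · have := norm_pos_iff.2 h
        positivity
    have h1 : (Real.sqrt (‖C‖ ^ 2 + ‖D‖ ^ 2)) ^ 2 = ‖C‖ ^ 2 + ‖D‖ ^ 2 := Real.sq_sqrt h0.le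
    simp only [norm_div, div_pow, Complex.norm_real, Real.norm_eq_abs, sq_abs]
    rw [h1, ← add_div, div_self h0.ne']⟩

theorem nz_pos {C D : ℂ} (h : ¬ (C = 0 ∧ D = 0)) : 0 < ‖C‖ ^ 2 + ‖D‖ ^ 2 := by
  rcases not_and_or.1 h with h | h
  · have := norm_pos_iff.2 h
    positivity
  · have := norm_pos_iff.2 h
    positivity

theorem nz_congr {C D C' D' : ℂ} (h : ¬ (C = 0 ∧ D = 0)) (h' : ¬ (C' = 0 ∧ D' = 0))
    (e : C = C') (e' : D = D') : nz C D h = nz C' D' h' := by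
  subst e; subst e'; rfl

variable {X : Type*} [TopologicalSpace X]

/-- The map to the sphere given by two functions without common zero. -/
noncomputable def sym (C D : C(X, ℂ)) (h : ∀ x, ¬ (C x = 0 ∧ D x = 0)) : C(X, Sphere3) :=
  ⟨fun x => nz (C x) (D x) (h x), by
    refine Continuous.subtype_mk ?_ _
    have hn : ∀ x, ((Real.sqrt (‖C x‖ ^ 2 + ‖D x‖ ^ 2) : ℝ) : ℂ) ≠ 0 := fun x => by
      have := Real.sqrt_pos.2 (nz_pos (h x))
      exact_mod_cast this.ne'
    have hc : Continuous fun x => ((Real.sqrt (‖C x‖ ^ 2 + ‖D x‖ ^ 2) : ℝ) : ℂ) := by fun_prop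
    exact (C.continuous.div hc hn).prodMk (D.continuous.div hc hn)⟩

theorem nz_mul {C D C' D' : ℂ} (h : ¬ (C = 0 ∧ D = 0)) (h' : ¬ (C' = 0 ∧ D' = 0))
    (h'' : ¬ (C * C' - conj D * D' = 0 ∧ D * C' + conj C * D' = 0)) :
    nz C D h * nz C' D' h' = nz _ _ h'' := by
  have e := sphere_norm_aux C D C' D'
  have hn : ((Real.sqrt (‖C‖ ^ 2 + ‖D‖ ^ 2) : ℝ) : ℂ) ≠ 0 := by
    have := Real.sqrt_pos.2 (nz_pos h)
    exact_mod_cast this.ne'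
  have hn' : ((Real.sqrt (‖C'‖ ^ 2 + ‖D'‖ ^ 2) : ℝ) : ℂ) ≠ 0 := by
    have := Real.sqrt_pos.2 (nz_pos h')
    exact_mod_cast this.ne'
  apply Subtype.ext
  simp only [mul_val, nz]
  rw [e, Real.sqrt_mul (by positivity)]
  apply Prod.ext
  · simp
    field_simp
  · simp
    field_simp

theorem nz_mul_ne {C D C' D' : ℂ} (h : ¬ (C = 0 ∧ D = 0)) (h' : ¬ (C' = 0 ∧ D' = 0)) :
    ¬ (C * C' - conj D * D' = 0 ∧ D * C' + conj C * D' = 0) := by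
  rintro ⟨h1, h2⟩
  have e := sphere_norm_aux C D C' D'
  rw [h1, h2] at e
  have := mul_pos (nz_pos h) (nz_pos h')
  rw [← e] at this
  simp at this

/-- A point of the sphere is its own normalisation. -/
theorem nz_self (x : Sphere3) (h : ¬ (x.1.1 = 0 ∧ x.1.2 = 0)) : nz x.1.1 x.1.2 h = x := by
  apply Subtype.ext
  simp [nz, x.2]

theorem sphere_ne (x : Sphere3) : ¬ (x.1.1 = 0 ∧ x.1.2 = 0) := by
  rintro ⟨h1, h2⟩
  have := x.2
  simp [h1, h2] at this

/-- Homotopy congruence. -/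
noncomputable def hCon (X : Type*) [TopologicalSpace X] : Con C(X, Sphere3) where
  toSetoid := ⟨ContinuousMap.Homotopic, ContinuousMap.Homotopic.equivalence⟩
  mul' := by
    rintro a b c d ⟨H⟩ ⟨K⟩
    refine ⟨⟨⟨fun z => H z * K z, by fun_prop⟩, ?_, ?_⟩⟩
    · intro x; simp
    · intro x; simp

/-- Group of homotopy classes of maps to the 3-sphere. -/
abbrev Gam (X : Type*) [TopologicalSpace X] : Type _ := (hCon X).Quotient

/-- class of a map -/
noncomputable def cl (f : C(X, Sphere3)) : Gam X := (f : (hCon X).Quotient)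

theorem cl_mul (f g : C(X, Sphere3)) : cl (f * g) = cl f * cl g := rfl
theorem cl_zpow (f : C(X, Sphere3)) (n : ℤ) : cl (f ^ n) = cl f ^ n := rfl
theorem cl_inv (f : C(X, Sphere3)) : cl (f⁻¹) = (cl f)⁻¹ := rfl
theorem cl_one : cl (1 : C(X, Sphere3)) = 1 := rfl
theorem cl_eq {f g : C(X, Sphere3)} : cl f = cl g ↔ f.Homotopic g := (hCon X).eq

theorem sym_homotopy (A B : C(unitInterval × X, ℂ)) (h : ∀ z, ¬ (A z = 0 ∧ B z = 0))
    (C D C' D' : C(X, ℂ)) (h0) (h1) (e1 : ∀ x, A (0, x) = C x) (e2 : ∀ x, B (0, x) = D x)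
    (e3 : ∀ x, A (1, x) = C' x) (e4 : ∀ x, B (1, x) = D' x) :
    cl (sym C D h0) = cl (sym C' D' h1) := by
  rw [cl_eq]
  refine ⟨⟨sym A B h, ?_, ?_⟩⟩
  · intro x; exact nz_congr (h _) (h0 _) (e1 x) (e2 x)
  · intro x; exact nz_congr (h _) (h1 _) (e3 x) (e4 x)

end LensProof

end parta

section partb
open ComplexConjugate

namespace LensProof
variable {X : Type*} [TopologicalSpace X]

theorem sym_mul (C D C' D' : C(X, ℂ)) (h h') (E F : C(X, ℂ)) (h'')
    (e1 : ∀ x, E x = C x * C' x - conj (D x) * D' x)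
    (e2 : ∀ x, F x = D x * C' x + conj (C x) * D' x) :
    cl (sym C D h) * cl (sym C' D' h') = cl (sym E F h'') := by
  rw [← cl_mul]
  congr 1
  ext1 x
  show nz _ _ (h x) * nz _ _ (h' x) = nz _ _ (h'' x)
  rw [nz_mul (h x) (h' x) (nz_mul_ne (h x) (h' x))]
  exact nz_congr _ _ (e1 x).symm (e2 x).symm

theorem hc_conj : Continuous (fun a : ℂ => conj a) := Complex.continuous_conj

theorem conj_mul_self' (a : ℂ) : conj a * a = ((Complex.normSq a : ℝ) : ℂ) := by
  rw [mul_comm, Complex.mul_conj]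

theorem ns_pos {a : ℂ} (h : a ≠ 0) : 0 < Complex.normSq a := Complex.normSq_pos.2 h

theorem stage1 (w D : ℂ) (n : ℕ) (t : ℝ) (h : ¬ (w = 0 ∧ D = 0)) :
    ¬ (w ^ (n + 1) - ((1 - t : ℝ) + (t : ℝ) * Complex.I) * (conj D * D) = 0 ∧
      D * (w ^ n + conj w) = 0) := by
  rintro ⟨h1, h2⟩
  by_cases hD : D = 0
  · subst hD
    simp at h1
    exact h ⟨h1, rfl⟩
  have h3 : w ^ n = - conj w := by
    have := (mul_eq_zero.1 h2).resolve_left hD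
    exact eq_neg_of_add_eq_zero_left this
  rw [pow_succ, h3, neg_mul, conj_mul_self', conj_mul_self'] at h1
  have hd := ns_pos hD
  have him := congrArg Complex.im h1
  have hre := congrArg Complex.re h1
  simp at him hre
  rcases him with him | him
  · subst him
    nlinarith [Complex.normSq_nonneg w]
  · exact hD him

theorem stage2 (w D : ℂ) (n : ℕ) (t : ℝ) (h : ¬ (w = 0 ∧ D = 0)) :
    ¬ (w ^ (n + 1) - Complex.I * (conj D * D) = 0 ∧
      D * (((1 - t : ℝ) : ℂ) * w ^ n + conj w) = 0) := by
  rintro ⟨h1, h2⟩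
  by_cases hD : D = 0
  · subst hD
    simp at h1
    exact h ⟨h1, rfl⟩
  have h3 : ((1 - t : ℝ) : ℂ) * w ^ n + conj w = 0 := (mul_eq_zero.1 h2).resolve_left hD
  have hd := ns_pos hD
  have h4 : ((1 - t : ℝ) : ℂ) * (Complex.I * (conj D * D)) + conj w * w = 0 := by
    rw [← sub_eq_zero.1 h1]
    linear_combination w * h3
  rw [conj_mul_self', conj_mul_self'] at h4
  have him := congrArg Complex.im h4
  simp at him
  rcases him with him | him
  · have : w = 0 := by
      have : t = 1 := by linarith
      subst this
      simpa using h4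
    subst this
    simp [hD] at h1
  · exact hD him

theorem stage3 (w D : ℂ) (n : ℕ) (t : ℝ) (h : ¬ (w = 0 ∧ D = 0)) :
    ¬ (w ^ (n + 1) - Complex.I * (conj D * D) = 0 ∧
      D * (((1 - t : ℝ) : ℂ) * conj w + (t : ℝ)) = 0) := by
  rintro ⟨h1, h2⟩
  by_cases hD : D = 0
  · subst hD
    simp at h1
    exact h ⟨h1, rfl⟩
  have h3 := (mul_eq_zero.1 h2).resolve_left hD
  have hd := ns_pos hD
  have ht : t ≠ 1 := by
    rintro rfl
    simp at h3
  have hre := congrArg Complex.re h3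
  have him := congrArg Complex.im h3
  simp at him hre
  have him' : w.im = 0 := him.resolve_left (fun h => ht (by linarith))
  have hw : w = (w.re : ℂ) := by
    apply Complex.ext <;> simp [him']
  rw [hw, conj_mul_self', ← Complex.ofReal_pow] at h1
  have := congrArg Complex.im h1
  rw [Complex.sub_im, Complex.ofReal_im] at this
  simp at this
  exact hD this

theorem stage4 (w D : ℂ) (n : ℕ) (s : ℂ) (h : ¬ (w = 0 ∧ D = 0)) :
    ¬ (w ^ (n + 1) - s * (conj D * D) = 0 ∧ D = 0) := by
  rintro ⟨h1, rfl⟩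
  simp at h1
  exact h ⟨h1, rfl⟩

theorem sym_pow_succ (w D : C(X, ℂ)) (n : ℕ) (h : ∀ x, ¬ (w x = 0 ∧ D x = 0)) (h1) (hn) :
    cl (sym (w ^ (n + 1)) D h1) = cl (sym w D h) * cl (sym (w ^ n) D hn) := by
  have hcc := hc_conj
  symm
  let E0 : C(X, ℂ) := ⟨fun x => w x ^ (n + 1) - conj (D x) * D x, by fun_prop⟩
  let F0 : C(X, ℂ) := ⟨fun x => D x * (w x ^ n + conj (w x)), by fun_prop⟩
  have k0 : ∀ x, ¬ (E0 x = 0 ∧ F0 x = 0) := fun x => by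
    have := stage1 (w x) (D x) n 0 (h x)
    simpa [E0, F0] using this
  rw [sym_mul w D (w ^ n) D h hn E0 F0 k0 (by intro x; simp [E0]; ring) (by intro x; simp [F0]; ring)]
  let E1 : C(X, ℂ) := ⟨fun x => w x ^ (n + 1) - Complex.I * (conj (D x) * D x), by fun_prop⟩
  have k1 : ∀ x, ¬ (E1 x = 0 ∧ F0 x = 0) := fun x => by
    have := stage1 (w x) (D x) n 1 (h x)
    simpa [E1, F0] using this
  rw [sym_homotopy
    ⟨fun z : unitInterval × X => w z.2 ^ (n + 1) -
      ((1 - (z.1 : ℝ) : ℝ) + ((z.1 : ℝ) : ℝ) * Complex.I) * (conj (D z.2) * D z.2), by fun_prop⟩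
    ⟨fun z => D z.2 * (w z.2 ^ n + conj (w z.2)), by fun_prop⟩
    (fun z => stage1 (w z.2) (D z.2) n z.1 (h z.2)) E0 F0 E1 F0 k0 k1
    (by intro x; simp [E0]) (by intro x; simp [F0]) (by intro x; simp [E1]) (by intro x; simp [F0])]
  let F2 : C(X, ℂ) := ⟨fun x => D x * conj (w x), by fun_prop⟩
  have k2 : ∀ x, ¬ (E1 x = 0 ∧ F2 x = 0) := fun x => by
    have := stage2 (w x) (D x) n 1 (h x)
    simpa [E1, F2] using this
  rw [sym_homotopy
    ⟨fun z : unitInterval × X => w z.2 ^ (n + 1) - Complex.I * (conj (D z.2) * D z.2), by fun_prop⟩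
    ⟨fun z => D z.2 * (((1 - (z.1 : ℝ) : ℝ) : ℂ) * w z.2 ^ n + conj (w z.2)), by fun_prop⟩
    (fun z => stage2 (w z.2) (D z.2) n z.1 (h z.2)) E1 F0 E1 F2 k1 k2
    (by intro x; simp [E1]) (by intro x; simp [F0]) (by intro x; simp [E1]) (by intro x; simp [F2])]
  have k3 : ∀ x, ¬ (E1 x = 0 ∧ D x = 0) := fun x => stage4 (w x) (D x) n _ (h x)
  rw [sym_homotopy
    ⟨fun z : unitInterval × X => w z.2 ^ (n + 1) - Complex.I * (conj (D z.2) * D z.2), by fun_prop⟩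
    ⟨fun z => D z.2 * (((1 - (z.1 : ℝ) : ℝ) : ℂ) * conj (w z.2) + ((z.1 : ℝ) : ℝ)), by fun_prop⟩
    (fun z => stage3 (w z.2) (D z.2) n z.1 (h z.2)) E1 F2 E1 D k2 k3
    (by intro x; simp [E1]) (by intro x; simp [F2]) (by intro x; simp [E1]) (by intro x; simp)]
  exact sym_homotopy
    ⟨fun z : unitInterval × X => w z.2 ^ (n + 1) -
      (((1 - (z.1 : ℝ) : ℝ) : ℂ) * Complex.I) * (conj (D z.2) * D z.2), by fun_prop⟩
    ⟨fun z => D z.2, by fun_prop⟩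
    (fun z => stage4 (w z.2) (D z.2) n _ (h z.2)) E1 D (w ^ (n + 1)) D k3 h1
    (by intro x; simp [E1]) (by intro x; simp) (by intro x; simp) (by intro x; simp)

theorem sym_one (D : C(X, ℂ)) (h) : cl (sym 1 D h) = 1 := by
  rw [← cl_one]
  have h0 : ∀ x : X, ¬ ((1 : C(X, ℂ)) x = 0 ∧ (0 : C(X, ℂ)) x = 0) := by simp
  have e : (1 : C(X, Sphere3)) = sym 1 0 h0 := by
    ext1 x
    apply Subtype.ext
    simp [sym, nz, one_val]
  rw [e]
  exact sym_homotopy ⟨fun z : unitInterval × X => 1, by fun_prop⟩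
    ⟨fun z => ((1 - (z.1 : ℝ) : ℝ) : ℂ) * D z.2, by fun_prop⟩ (by intro z; simp) 1 D 1 0 h h0
    (by intro x; simp) (by intro x; simp) (by intro x; simp) (by intro x; simp)

theorem sym_pow_left (w D : C(X, ℂ)) (n : ℕ) (h : ∀ x, ¬ (w x = 0 ∧ D x = 0)) (hn) :
    cl (sym (w ^ n) D hn) = cl (sym w D h) ^ n := by
  induction n with
  | zero => simpa using sym_one D (by simp)
  | succ n ih =>
    have hn' : ∀ x, ¬ ((w ^ n) x = 0 ∧ D x = 0) := by
      rintro x ⟨h1, h2⟩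
      refine h x ⟨?_, h2⟩
      simp at h1
      exact h1.1
    rw [sym_pow_succ w D n h hn hn', ih, pow_succ']

theorem sym_swap (C D : C(X, ℂ)) (h : ∀ x, ¬ (C x = 0 ∧ D x = 0)) (h') :
    cl (sym C D h) = cl (sym D C h') := by
  have hI : ∀ x, ¬ ((Complex.I • D) x = 0 ∧ (Complex.I • C) x = 0) := by
    intro x hx
    simp at hx
    exact h x ⟨hx.2, hx.1⟩
  have key : ∀ (t : ℝ) (a b : ℂ), ((1 - t : ℝ) : ℂ) * a + t * (Complex.I * b) = 0 ∧
      ((1 - t : ℝ) : ℂ) * b + t * (Complex.I * a) = 0 → a = 0 ∧ b = 0 := by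
    rintro t a b ⟨h1, h2⟩
    have hne : (((1 - t) ^ 2 + t ^ 2 : ℝ) : ℂ) ≠ 0 := by
      have : (0 : ℝ) < (1 - t) ^ 2 + t ^ 2 := by nlinarith [sq_nonneg (1 - t), sq_nonneg t]
      exact_mod_cast this.ne'
    push_cast at hne h1 h2
    have hI2 := Complex.I_sq
    constructor
    · refine (mul_eq_zero.1 (?_ : ((1 - t : ℂ) ^ 2 + t ^ 2) * a = 0)).resolve_left hne
      linear_combination (1 - t : ℂ) * h1 - t * Complex.I * h2 + t ^ 2 * a * hI2
    · refine (mul_eq_zero.1 (?_ : ((1 - t : ℂ) ^ 2 + t ^ 2) * b = 0)).resolve_left hne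
      linear_combination (1 - t : ℂ) * h2 - t * Complex.I * h1 + t ^ 2 * b * hI2
  rw [sym_homotopy ⟨fun z : unitInterval × X =>
      ((1 - (z.1 : ℝ) : ℝ) : ℂ) * C z.2 + ((z.1 : ℝ) : ℂ) * (Complex.I * D z.2), by fun_prop⟩
    ⟨fun z : unitInterval × X =>
      ((1 - (z.1 : ℝ) : ℝ) : ℂ) * D z.2 + ((z.1 : ℝ) : ℂ) * (Complex.I * C z.2), by fun_prop⟩
    (fun z hz => h z.2 (key _ _ _ hz)) C D (Complex.I • D) (Complex.I • C) h hI
    (by intro x; simp) (by intro x; simp) (by intro x; simp) (by intro x; simp)]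
  have key2 : ∀ t : ℝ, ((1 - t : ℝ) : ℂ) * Complex.I + (t : ℂ) ≠ 0 := by
    intro t ht
    have h1 := congrArg Complex.re ht
    have h2 := congrArg Complex.im ht
    simp at h1 h2
    linarith
  exact sym_homotopy ⟨fun z : unitInterval × X =>
      (((1 - (z.1 : ℝ) : ℝ) : ℂ) * Complex.I + ((z.1 : ℝ) : ℂ)) * D z.2, by fun_prop⟩
    ⟨fun z : unitInterval × X =>
      (((1 - (z.1 : ℝ) : ℝ) : ℂ) * Complex.I + ((z.1 : ℝ) : ℂ)) * C z.2, by fun_prop⟩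
    (fun z hz => h' z.2 ⟨(mul_eq_zero.1 hz.1).resolve_left (key2 _),
      (mul_eq_zero.1 hz.2).resolve_left (key2 _)⟩)
    (Complex.I • D) (Complex.I • C) D C hI h'
    (by intro x; simp) (by intro x; simp) (by intro x; simp) (by intro x; simp)

theorem sym_pow (C D : C(X, ℂ)) (m n : ℕ) (h : ∀ x, ¬ (C x = 0 ∧ D x = 0)) (h') :
    cl (sym (C ^ m) (D ^ n) h') = cl (sym C D h) ^ (m * n) := by
  by_cases hn : n = 0
  · subst hn
    rw [sym_swap _ _ _ (fun x hx => h' x hx.symm)]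
    simpa using sym_one (C ^ m) (by simp)
  have h1 : ∀ x, ¬ (C x = 0 ∧ (D ^ n) x = 0) := by
    rintro x ⟨h1, h2⟩
    refine h x ⟨h1, ?_⟩
    simpa [hn] using h2
  rw [sym_pow_left C (D ^ n) m h1, sym_swap _ _ _ (fun x hx => h1 x hx.symm),
    sym_pow_left D C n (fun x hx => h x hx.symm), sym_swap _ _ _ h, ← pow_mul, mul_comm]

end LensProof

end partb

section partc
open ComplexConjugate

namespace LensProof
variable {X : Type*} [TopologicalSpace X]

/-- first coordinate -/
def co1 : C(Sphere3, ℂ) := ⟨fun x => x.1.1, by fun_prop⟩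
/-- second coordinate -/
def co2 : C(Sphere3, ℂ) := ⟨fun x => x.1.2, by fun_prop⟩

theorem sym_co (h) : sym co1 co2 h = ContinuousMap.id _ := by
  ext1 x
  exact nz_self x (h x)

theorem key_ne (x : Sphere3) (t s : ℝ) (h1 : s ≠ 0 ∨ t ≠ 1)
    (h2 : x.1.2 = 0 → s * x.1.1.re ≠ -(1 - t)) :
    ¬ (((1 - t : ℝ) : ℂ) + s * x.1.1 = 0 ∧ (s : ℂ) * x.1.2 = 0) := by
  rintro ⟨e1, e2⟩
  rcases mul_eq_zero.1 e2 with e | e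
  · have : s = 0 := by exact_mod_cast e
    subst this
    rcases h1 with h | h
    · exact h rfl
    · simp at e1
      apply h
      have : (t : ℂ) = 1 := by linear_combination -e1
      exact_mod_cast this
  · apply h2 e
    have := congrArg Complex.re e1
    simp at this
    linarith

theorem re_sq (x : Sphere3) (t s : ℝ) (h : x.1.2 = 0) (hs : s ≠ 0)
    (e : ((1 - t : ℝ) : ℂ) + s * x.1.1 = 0) : x.1.1.re = 1 ∨ x.1.1.re = -1 := by
  have him := congrArg Complex.im e
  simp [hs] at him
  have := x.2
  rw [h, Complex.sq_norm, Complex.normSq_apply, him] at this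
  simp at this
  have h2 : (x.1.1.re - 1) * (x.1.1.re + 1) = 0 := by linear_combination this
  rcases mul_eq_zero.1 h2 with h | h
  · left; linarith
  · right; linarith

theorem uv_ne (x : Sphere3) (t : ℝ) (ht : 0 ≤ t ∧ t ≤ 1) (ε a : ℝ) (hε : ε = 1 ∨ ε = -1)
    (ha : a = max (-(ε * x.1.1.re)) 0) :
    ¬ (((1 - t : ℝ) : ℂ) + ((ε * (t + 2 * (1 - t) * a) : ℝ) : ℂ) * x.1.1 = 0 ∧
      ((ε * (t + 2 * (1 - t) * a) : ℝ) : ℂ) * x.1.2 = 0) := by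
  have ha0 : 0 ≤ a := ha ▸ le_max_right _ _
  have hε0 : ε ≠ 0 := by rcases hε with rfl | rfl <;> norm_num
  rintro ⟨e1, e2⟩
  have hs0 : 0 < t + 2 * (1 - t) * a := by
    rcases eq_or_lt_of_le ht.1 with h | h
    · subst h
      rcases eq_or_lt_of_le ha0 with h' | h'
      · rw [← h'] at e1
        simp at e1
      · linarith
    · have := mul_nonneg (sub_nonneg.2 ht.2) ha0
      linarith
  have hs1 : ε * (t + 2 * (1 - t) * a) ≠ 0 := mul_ne_zero hε0 hs0.ne'
  have hx : x.1.2 = 0 := (mul_eq_zero.1 e2).resolve_left (by exact_mod_cast hs1)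
  have hre := congrArg Complex.re e1
  rw [Complex.add_re, Complex.re_ofReal_mul, Complex.ofReal_re, Complex.zero_re] at hre
  have hr := re_sq x t _ hx hs1 e1
  have hq : ε * x.1.1.re = 1 ∨ ε * x.1.1.re = -1 := by
    rcases hε with rfl | rfl <;> rcases hr with h | h <;> rw [h] <;> norm_num
  have hre' : (1 - t) + (t + 2 * (1 - t) * a) * (ε * x.1.1.re) = 0 := by linear_combination hre
  rcases hq with h | h
  · rw [h] at hre'
    linarith [ht.2]
  · rw [h] at ha hre'
    have : a = 1 := by rw [ha]; norm_num
    subst this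
    linarith

/-- The folded map -/
noncomputable def fo (ε : ℝ) (hε : ε = 1 ∨ ε = -1) : C(Sphere3, Sphere3) :=
  sym ⟨fun x => 1 + ((ε * (2 * max (-(ε * x.1.1.re)) 0) : ℝ) : ℂ) * x.1.1, by fun_prop⟩
    ⟨fun x => ((ε * (2 * max (-(ε * x.1.1.re)) 0) : ℝ) : ℂ) * x.1.2, by fun_prop⟩
    (fun x => by simpa using uv_ne x 0 (by norm_num) ε _ hε rfl)

theorem fo_one (ε : ℝ) (hε) (x : Sphere3) (h : 0 ≤ ε * x.1.1.re) : fo ε hε x = 1 := by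
  apply Subtype.ext
  have : max (-(ε * x.1.1.re)) 0 = 0 := max_eq_right (by linarith)
  simp only [fo, sym, ContinuousMap.coe_mk, nz, this]
  simp [one_val]

theorem fo_cl (ε : ℝ) (hε) : cl (fo ε hε) = cl (ContinuousMap.id _) := by
  have hI := sphere_ne
  rw [← sym_co hI]
  have hε0 : ε ≠ 0 := by rcases hε with rfl | rfl <;> norm_num
  have hne : ∀ x, ¬ (((ε : ℂ) • co1) x = 0 ∧ ((ε : ℂ) • co2) x = 0) := by
    intro x hx
    simp [hε0] at hx
    exact hI x hx
  have h1 : cl (fo ε hε) = cl (sym ((ε : ℂ) • co1) ((ε : ℂ) • co2) hne) := by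
    refine sym_homotopy
      ⟨fun z : unitInterval × Sphere3 => ((1 - (z.1 : ℝ) : ℝ) : ℂ) +
        ((ε * ((z.1 : ℝ) + 2 * (1 - (z.1 : ℝ)) * max (-(ε * z.2.1.1.re)) 0) : ℝ) : ℂ) * z.2.1.1,
        by fun_prop⟩
      ⟨fun z : unitInterval × Sphere3 =>
        ((ε * ((z.1 : ℝ) + 2 * (1 - (z.1 : ℝ)) * max (-(ε * z.2.1.1.re)) 0) : ℝ) : ℂ) * z.2.1.2,
        by fun_prop⟩
      (fun z => uv_ne z.2 z.1 z.1.2 ε _ hε rfl) _ _ _ _ _ hne ?_ ?_ ?_ ?_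
    · intro x; simp
    · intro x; simp
    · intro x; simp [co1]
    · intro x; simp [co2]
  rw [h1]
  rcases hε with rfl | rfl
  · congr 1
    ext1 x
    refine nz_congr (hne x) (hI x) ?_ ?_ <;> simp [co1, co2]
  · refine sym_homotopy ⟨fun z : unitInterval × Sphere3 =>
        Complex.exp (Real.pi * (1 - ((z.1 : ℝ) : ℂ)) * Complex.I) * co1 z.2, by fun_prop⟩
      ⟨fun z : unitInterval × Sphere3 =>
        Complex.exp (Real.pi * (1 - ((z.1 : ℝ) : ℂ)) * Complex.I) * co2 z.2, by fun_prop⟩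
      ?_ _ _ _ _ hne hI ?_ ?_ ?_ ?_
    · intro z hz
      simp [Complex.exp_ne_zero] at hz
      exact hI _ hz
    · intro x; simp [Complex.exp_pi_mul_I]
    · intro x; simp [Complex.exp_pi_mul_I]
    · intro x; simp
    · intro x; simp

theorem cl_comp_congr {f g : C(Sphere3, Sphere3)} (h : cl f = cl g) (k : C(X, Sphere3)) :
    cl (f.comp k) = cl (g.comp k) := by
  rw [cl_eq] at *
  exact h.comp (ContinuousMap.Homotopic.refl k)

theorem nil2 (a b : Gam X) : Commute a (a * b * a⁻¹ * b⁻¹) := by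
  induction a using Con.induction_on with | _ f
  induction b using Con.induction_on with | _ g
  change Commute (cl f) (cl f * cl g * (cl f)⁻¹ * (cl g)⁻¹)
  have hu : cl ((fo 1 (Or.inl rfl)).comp f) = cl f := by
    rw [cl_comp_congr (fo_cl _ _) f, ContinuousMap.id_comp]
  have hv : cl ((fo (-1) (Or.inr rfl)).comp f) = cl f := by
    rw [cl_comp_congr (fo_cl _ _) f, ContinuousMap.id_comp]
  set u := (fo 1 (Or.inl rfl)).comp f with hu'
  set v := (fo (-1) (Or.inr rfl)).comp f with hv'
  have key : Commute u (v * g * v⁻¹ * g⁻¹) := by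
    show _ = _
    ext1 x
    rcases le_total 0 (f x).1.1.re with h | h
    · have : u x = 1 := fo_one 1 (Or.inl rfl) _ (by linarith)
      simp [this]
    · have : v x = 1 := fo_one (-1) (Or.inr rfl) _ (by linarith)
      simp [this]
  have := congrArg cl key
  simp only [cl_mul, cl_inv, hu, hv] at this
  exact this

section Alg
variable {Γ : Type*} [Group Γ]

theorem com_zpow {x y c : Γ} (hc : c = x * y * x⁻¹ * y⁻¹) (hx : Commute x c) (hy : Commute y c)
    (α β : ℤ) : x ^ α * y ^ β = y ^ β * x ^ α * c ^ (α * β) := by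
  have h1 : x * y * x⁻¹ = c * y := by rw [hc]; group
  have h2 : x * y ^ β * x⁻¹ = c ^ β * y ^ β := by
    rw [← hy.symm.mul_zpow, ← h1, conj_zpow]
  have h3 : (y ^ β)⁻¹ * x * (y ^ β) = c ^ β * x := by
    have h4 : x * y ^ β = c ^ β * y ^ β * x := by rw [← h2]; group
    have h5 := (hy.zpow_zpow β β).eq
    rw [mul_assoc, h4, ← h5]; group
  have h6 : (y ^ β)⁻¹ * x ^ α * (y ^ β) = c ^ (β * α) * x ^ α := by
    have := conj_zpow (i := α) (a := (y ^ β)⁻¹) (b := x)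
    rw [inv_inv] at this
    rw [← this, h3, (hx.zpow_right β).symm.mul_zpow, zpow_mul]
  have h7 := (hx.zpow_zpow α (α * β)).eq
  rw [mul_assoc, h7, mul_comm α β, ← h6]; group

/-- normal form -/
def NF (x y c : Γ) (w : Γ) (α β : ℤ) : Prop := ∃ k : ℤ, w = x ^ α * y ^ β * c ^ k

theorem NF.mul {x y c : Γ} (hc : c = x * y * x⁻¹ * y⁻¹) (hx : Commute x c) (hy : Commute y c)
    {w w' : Γ} {α β α' β' : ℤ} (h : NF x y c w α β) (h' : NF x y c w' α' β') :
    NF x y c (w * w') (α + α') (β + β') := by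
  obtain ⟨k, rfl⟩ := h
  obtain ⟨k', rfl⟩ := h'
  refine ⟨k + k' - α' * β, ?_⟩
  have h1 := com_zpow hc hx hy α' β
  have h2 : y ^ β * x ^ α' = x ^ α' * y ^ β * c ^ (-(α' * β)) := by
    rw [h1]; simp
  have hxk : ∀ m n : ℤ, c ^ m * x ^ n = x ^ n * c ^ m := fun m n => (hx.zpow_zpow n m).eq.symm
  have hyk : ∀ m n : ℤ, c ^ m * y ^ n = y ^ n * c ^ m := fun m n => (hy.zpow_zpow n m).eq.symm
  calc x ^ α * y ^ β * c ^ k * (x ^ α' * y ^ β' * c ^ k')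
      = x ^ α * y ^ β * (c ^ k * x ^ α') * y ^ β' * c ^ k' := by group
    _ = x ^ α * (y ^ β * x ^ α') * (c ^ k * y ^ β') * c ^ k' := by rw [hxk]; group
    _ = x ^ α * x ^ α' * y ^ β * (c ^ (-(α' * β)) * y ^ β') * c ^ k * c ^ k' := by
        rw [h2, hyk]; simp only [mul_assoc]
    _ = _ := by rw [hyk]; group

theorem NF.inv {x y c : Γ} (hc : c = x * y * x⁻¹ * y⁻¹) (hx : Commute x c) (hy : Commute y c)
    {w : Γ} {α β : ℤ} (h : NF x y c w α β) : NF x y c w⁻¹ (-α) (-β) := by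
  obtain ⟨k, rfl⟩ := h
  have h1 : NF x y c (c ^ (-k)) 0 0 := ⟨-k, by simp⟩
  have h2 : NF x y c (y ^ (-β)) 0 (-β) := ⟨0, by simp⟩
  have h3 : NF x y c (x ^ (-α)) (-α) 0 := ⟨0, by simp⟩
  have := (h1.mul hc hx hy h2).mul hc hx hy h3
  simpa [mul_assoc] using this

theorem NF.zpow {x y c : Γ} (hc : c = x * y * x⁻¹ * y⁻¹) (hx : Commute x c) (hy : Commute y c)
    {w : Γ} {α β : ℤ} (h : NF x y c w α β) (n : ℤ) : NF x y c (w ^ n) (n * α) (n * β) := by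
  induction n with
  | zero => exact ⟨0, by simp⟩
  | succ n ih =>
    have := ih.mul hc hx hy h
    rw [zpow_add_one, add_mul, add_mul, one_mul, one_mul]
    exact this
  | pred n ih =>
    have := ih.mul hc hx hy (h.inv hc hx hy)
    rw [zpow_sub_one, sub_mul, sub_mul, one_mul, one_mul]
    exact this

theorem conj_NF {x y c : Γ} (hc : c = x * y * x⁻¹ * y⁻¹) (hx : Commute x c) (hy : Commute y c)
    (i j α β k : ℤ) : (x ^ i * y ^ j) * (x ^ α * y ^ β * c ^ k) * (x ^ i * y ^ j)⁻¹ =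
      x ^ α * y ^ β * c ^ (k + i * β - j * α) := by
  have hxk : ∀ m n : ℤ, c ^ m * x ^ n = x ^ n * c ^ m := fun m n => (hx.zpow_zpow n m).eq.symm
  have hyk : ∀ m n : ℤ, c ^ m * y ^ n = y ^ n * c ^ m := fun m n => (hy.zpow_zpow n m).eq.symm
  have h1 := com_zpow hc hx hy
  rw [mul_inv_eq_iff_eq_mul]
  have e1 : x ^ i * y ^ j * (x ^ α * y ^ β * c ^ k)
      = x ^ (i + α) * y ^ (j + β) * c ^ (k - α * j) := by
    have h2 : y ^ j * x ^ α = x ^ α * y ^ j * c ^ (-(α * j)) := by rw [h1]; simp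
    calc _ = x ^ i * (y ^ j * x ^ α) * y ^ β * c ^ k := by group
      _ = x ^ i * x ^ α * y ^ j * (c ^ (-(α * j)) * y ^ β) * c ^ k := by
        rw [h2]; simp only [mul_assoc]
      _ = _ := by rw [hyk]; group
  have e2 : x ^ α * y ^ β * c ^ (k + i * β - j * α) * (x ^ i * y ^ j)
      = x ^ (i + α) * y ^ (j + β) * c ^ (k - α * j) := by
    have h2 : y ^ β * x ^ i = x ^ i * y ^ β * c ^ (-(i * β)) := by rw [h1]; simp
    calc _ = x ^ α * y ^ β * (c ^ (k + i * β - j * α) * x ^ i) * y ^ j := by group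
      _ = x ^ α * (y ^ β * x ^ i) * (c ^ (k + i * β - j * α) * y ^ j) := by
        rw [hxk]; simp only [mul_assoc]
      _ = x ^ α * (x ^ i * y ^ β) * (c ^ (-(i * β)) * y ^ j) * c ^ (k + i * β - j * α) := by
        rw [h2, hyk]; simp only [mul_assoc]
      _ = (x ^ α * x ^ i) * (y ^ β * y ^ j) * (c ^ (-(i * β)) * c ^ (k + i * β - j * α)) := by
        rw [hyk]; simp only [mul_assoc]
      _ = _ := by
        simp only [← zpow_add]
        rw [add_comm α i, add_comm β j,
          show -(i * β) + (k + i * β - j * α) = k - α * j by ring]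
  rw [e1, e2]

theorem alg_main {x y c : Γ} (hc : c = x * y * x⁻¹ * y⁻¹) (hx : Commute x c) (hy : Commute y c)
    {w w' : Γ} {d₁ e f d₂ : ℤ} (h : NF x y c w d₁ e) (h' : NF x y c w' f d₂)
    (hd : d₁ * d₂ - e * f = 1) : ∃ i j : ℤ,
      (x ^ i * y ^ j) * w * (x ^ i * y ^ j)⁻¹ = x ^ d₁ * y ^ e ∧
      (x ^ i * y ^ j) * w' * (x ^ i * y ^ j)⁻¹ = y ^ d₂ * x ^ f := by
  obtain ⟨k, rfl⟩ := h
  obtain ⟨l, rfl⟩ := h'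
  refine ⟨k * f - d₁ * (l + f * d₂), - e * (l + f * d₂) + d₂ * k, ?_, ?_⟩
  · rw [conj_NF hc hx hy]
    have : k + (k * f - d₁ * (l + f * d₂)) * e - (-e * (l + f * d₂) + d₂ * k) * d₁ = 0 := by
      linear_combination (-k) * hd
    rw [this]; simp
  · rw [conj_NF hc hx hy]
    have : l + (k * f - d₁ * (l + f * d₂)) * d₂ - (-e * (l + f * d₂) + d₂ * k) * f = -(f * d₂) := by
      linear_combination (-(l + f * d₂)) * hd
    rw [this, com_zpow hc hx hy f d₂]; simp

end Alg
end LensProof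

end partc

section partd
namespace LensProof

/-- A continuous action. -/
structure Act (G X : Type*) [AddCommGroup G] [TopologicalSpace X] where
  act : G → X → X
  cont : ∀ g, Continuous (act g)
  zero : ∀ x, act 0 x = x
  add : ∀ g h x, act (g + h) x = act g (act h x)

theorem Act.neg_act {G X : Type*} [AddCommGroup G] [TopologicalSpace X] (A : Act G X) (g : G)
    (x : X) : A.act (-g) (A.act g x) = x := by rw [← A.add, neg_add_cancel, A.zero]

theorem Act.act_neg {G X : Type*} [AddCommGroup G] [TopologicalSpace X] (A : Act G X) (g : G)
    (x : X) : A.act g (A.act (-g) x) = x := by rw [← A.add, add_neg_cancel, A.zero]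

section Merge
open Topology Filter
variable {G E Y : Type*} [AddCommGroup G] [Fintype G] [TopologicalSpace E] [MetricSpace Y]

/-- Existence of charts. -/
theorem exists_chart (AY : Act G Y) (hfree : ∀ g y, AY.act g y = y → g = 0) (y₀ : Y) :
    ∃ (b : Y → ℝ) (sel : Y → G), Continuous b ∧ (∀ y, 0 ≤ b y) ∧ (∀ g y, b (AY.act g y) = b y) ∧
      0 < b y₀ ∧ (∀ y, 0 < b y → (∀ g, sel (AY.act g y) = g + sel y) ∧
        ∀ᶠ y' in 𝓝 y, sel y' = sel y) := by
  classical
  have h1 : ∀ᶠ z : Y × Y in 𝓝 (y₀, y₀), ∀ k : G, k ≠ 0 → AY.act k z.1 ≠ z.2 := by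
    rw [eventually_all]
    intro k
    by_cases hk : k = 0
    · exact Eventually.of_forall fun z h => absurd hk h
    have hc : Continuous fun z : Y × Y => AY.act k z.1 := (AY.cont k).comp continuous_fst
    have ho : IsOpen {z : Y × Y | AY.act k z.1 ≠ z.2} := isOpen_ne_fun hc continuous_snd
    filter_upwards [ho.mem_nhds (show AY.act k y₀ ≠ y₀ from fun h => hk (hfree _ _ h))] with z hz _
    exact hz
  obtain ⟨ε, hε, h2⟩ := Metric.eventually_nhds_iff.1 h1
  have h3 : ∀ y z : Y, dist y y₀ < ε → dist z y₀ < ε → ∀ k : G, AY.act k y = z → k = 0 := by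
    intro y z hy hz k hk
    by_contra hk0
    exact h2 (y := (y, z)) (by rw [Prod.dist_eq]; exact max_lt hy hz) k hk0 hk
  let β : Y → ℝ := fun y => max 0 (ε - dist y y₀)
  have hβc : Continuous β := by fun_prop
  have hβ0 : ∀ y, 0 ≤ β y := fun y => le_max_left _ _
  have hβ1 : ∀ y, 0 < β y → dist y y₀ < ε := by
    intro y hy
    rcases lt_max_iff.1 hy with h | h
    · exact absurd h (lt_irrefl _)
    · linarith
  have huniq : ∀ (y : Y) (g h : G), 0 < β (AY.act (-g) y) → 0 < β (AY.act (-h) y) → g = h := by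
    intro y g h hg hh
    have := h3 _ _ (hβ1 _ hg) (hβ1 _ hh) (-h + g) (by rw [← AY.add]; congr 1; abel)
    have h4 : g = h + (-h + g) := by abel
    rw [h4, this, add_zero]
  let sel : Y → G := fun y => if h : ∃ g, 0 < β (AY.act (-g) y) then h.choose else 0
  have hsel : ∀ y g, 0 < β (AY.act (-g) y) → sel y = g := by
    intro y g hg
    have h : ∃ g, 0 < β (AY.act (-g) y) := ⟨g, hg⟩
    have : sel y = h.choose := dif_pos h
    rw [this]
    exact huniq y _ _ h.choose_spec hg
  refine ⟨fun y => ∑ g, β (AY.act (-g) y), sel, ?_, ?_, ?_, ?_, ?_⟩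
  · exact continuous_finsetSum _ fun g _ => hβc.comp (AY.cont _)
  · exact fun y => Finset.sum_nonneg fun g _ => hβ0 _
  · intro g y
    refine Fintype.sum_equiv (Equiv.subRight g) _ _ fun h => ?_
    rw [← AY.add]
    congr 2
    simp [sub_eq_add_neg, add_comm]
  · refine Finset.sum_pos' (fun g _ => hβ0 _) ⟨0, Finset.mem_univ _, ?_⟩
    simp [AY.zero, β, hε]
  · intro y hy
    have : ∃ g, 0 < β (AY.act (-g) y) := by
      by_contra hcon
      push Not at hcon
      have : ∑ g, β (AY.act (-g) y) ≤ 0 := Finset.sum_nonpos fun g _ => hcon g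
      exact absurd hy (not_lt.2 this)
    obtain ⟨g, hg⟩ := this
    constructor
    · intro k
      rw [hsel y g hg]
      apply hsel
      rw [← AY.add]
      have : -(k + g) + k = -g := by abel
      rwa [this]
    · have hc : Continuous fun y' => β (AY.act (-g) y') := hβc.comp (AY.cont _)
      filter_upwards [(isOpen_lt continuous_const hc).mem_nhds hg] with y' hy'
      rw [hsel y g hg, hsel y' g hy']

variable (AE : Act G E) (AY : Act G Y) (pr : E → Y)

/-- partial sections over the locus where `a` is positive -/
def PSec (a : Y → ℝ) : Prop := ∃ σ : Y → E, ∀ y, 0 < a y →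
  pr (σ y) = y ∧ ContinuousAt σ y ∧ ∀ g, σ (AY.act g y) = AE.act g (σ y)

theorem psec_merge
    (hpa : ∀ g e, pr (AE.act g e) = AY.act g (pr e))
    (D : ℝ → E → E) (hD : Continuous fun z : ℝ × E => D z.1 z.2) (cen : Y → E)
    (hcen : Continuous cen) (hpc : ∀ y, pr (cen y) = y) (hD0 : ∀ t e, t ≤ 0 → D t e = e)
    (hD1 : ∀ t e, 1 ≤ t → D t e = cen (pr e)) (hDp : ∀ t e, pr (D t e) = pr e)
    (a b : Y → ℝ) (sel : Y → G) (ha : Continuous a) (hb : Continuous b)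
    (ha0 : ∀ y, 0 ≤ a y) (hb0 : ∀ y, 0 ≤ b y)
    (hai : ∀ g y, a (AY.act g y) = a y) (hbi : ∀ g y, b (AY.act g y) = b y)
    (hsel : ∀ y, 0 < b y → (∀ g, sel (AY.act g y) = g + sel y) ∧
        ∀ᶠ y' in 𝓝 y, sel y' = sel y) (hs : PSec AE AY pr a) :
    PSec AE AY pr (fun y => a y + b y) := by
  classical
  obtain ⟨σ, hσ⟩ := hs
  let e : Y → E := fun y => if 0 < a y then σ y else cen y
  have he : ∀ y, pr (e y) = y := by
    intro y
    by_cases h : 0 < a y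
    · simp only [e, if_pos h]; exact (hσ y h).1
    · simp only [e, if_neg h]; exact hpc y
  have he1 : ∀ y, 0 < a y → e y = σ y := fun y h => if_pos h
  let t : Y → ℝ := fun y => 3 * (b y / (a y + b y)) - 1
  have ht0 : ∀ y, 0 < a y + b y → 2 * b y ≤ a y → t y ≤ 0 := by
    intro y h0 h
    have : b y / (a y + b y) ≤ 1 / 3 := by
      rw [div_le_iff₀ h0]; linarith
    simp only [t]; linarith
  have ht1 : ∀ y, 0 < a y + b y → 2 * a y ≤ b y → 1 ≤ t y := by
    intro y h0 h
    have : 2 / 3 ≤ b y / (a y + b y) := by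
      rw [le_div_iff₀ h0]; linarith
    simp only [t]; linarith
  have hti : ∀ g y, t (AY.act g y) = t y := by
    intro g y; simp only [t, hai, hbi]
  let σ' : Y → E := fun y => AE.act (sel y) (D (t y) (AE.act (-sel y) (e y)))
  have hσ0 : ∀ y, 0 < a y + b y → 2 * b y ≤ a y → σ' y = σ y := by
    intro y h0 h
    have hay : 0 < a y := by linarith [hb0 y]
    simp only [σ']
    rw [hD0 _ _ (ht0 y h0 h), AE.act_neg, he1 y hay]
  have hσ1 : ∀ y, 0 < a y + b y → 2 * a y ≤ b y →
      σ' y = AE.act (sel y) (cen (AY.act (-sel y) y)) := by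
    intro y h0 h
    simp only [σ']
    rw [hD1 _ _ (ht1 y h0 h), hpa, he]
  refine ⟨σ', fun y hy => ⟨?_, ?_, ?_⟩⟩
  · simp only [σ']
    rw [hpa, hDp, hpa, he, AY.act_neg]
  · have hpos : ∀ᶠ y' in 𝓝 y, 0 < a y' + b y' :=
      (isOpen_lt continuous_const (ha.add hb)).mem_nhds hy
    rcases eq_or_lt_of_le (ha0 y) with h | h
    · have hby : 0 < b y := by linarith
      have h2 : ∀ᶠ y' in 𝓝 y, 2 * a y' < b y' :=
        (isOpen_lt (continuous_const.mul ha) hb).mem_nhds (show 2 * a y < b y by linarith)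
      have hc : ContinuousAt (fun y' => AE.act (sel y) (cen (AY.act (-sel y) y'))) y :=
        ((AE.cont _).comp (hcen.comp (AY.cont _))).continuousAt
      refine hc.congr ?_
      filter_upwards [hpos, h2, (hsel y hby).2] with y' h0 h1 h3
      rw [hσ1 y' h0 h1.le, h3]
    · rcases eq_or_lt_of_le (hb0 y) with h' | h'
      · have h2 : ∀ᶠ y' in 𝓝 y, 2 * b y' < a y' :=
          (isOpen_lt (continuous_const.mul hb) ha).mem_nhds (show 2 * b y < a y by linarith)
        refine (hσ y h).2.1.congr ?_
        filter_upwards [hpos, h2] with y' h0 h1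
        rw [hσ0 y' h0 h1.le]
      · have h2 : ∀ᶠ y' in 𝓝 y, 0 < a y' := (isOpen_lt continuous_const ha).mem_nhds h
        have htc : ContinuousAt t y := by
          have : ContinuousAt (fun y => b y / (a y + b y)) y :=
            hb.continuousAt.div (ha.add hb).continuousAt hy.ne'
          exact (continuousAt_const.mul this).sub continuousAt_const
        have hc1 : ContinuousAt (fun y' => AE.act (-sel y) (σ y')) y :=
          (AE.cont _).continuousAt.comp (hσ y h).2.1
        have hc : ContinuousAt (fun y' => AE.act (sel y) (D (t y') (AE.act (-sel y) (σ y')))) y :=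
          ((AE.cont (sel y)).comp hD).continuousAt.comp (htc.prodMk hc1)
        refine hc.congr ?_
        filter_upwards [h2, (hsel y h').2] with y' h0 h3
        simp only [σ']
        rw [he1 y' h0, h3]
  · intro g
    rcases eq_or_lt_of_le (hb0 y) with h' | h'
    · have hay : 0 < a y := by linarith
      rw [hσ0 y hy (by linarith), hσ0 _ (by rw [hai, hbi]; exact hy) (by rw [hai, hbi]; linarith)]
      exact (hσ y hay).2.2 g
    · have hs1 := (hsel y h').1 g
      rcases eq_or_lt_of_le (ha0 y) with h | h
      · rw [hσ1 y hy (by linarith), hσ1 _ (by rw [hai, hbi]; exact hy) (by rw [hai, hbi]; linarith),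
          hs1, AE.add, ← AY.add, show -(g + sel y) + g = -sel y by abel]
      · simp only [σ']
        rw [he1 y h, he1 _ (by rw [hai]; exact h), hti, hs1, (hσ y h).2.2, AE.add g (sel y), ← AE.add _ g (σ y),
          show -(g + sel y) + g = -sel y by abel]

theorem exists_section [CompactSpace Y] (hfree : ∀ g y, AY.act g y = y → g = 0)
    (hpa : ∀ g e, pr (AE.act g e) = AY.act g (pr e))
    (D : ℝ → E → E) (hD : Continuous fun z : ℝ × E => D z.1 z.2) (cen : Y → E)
    (hcen : Continuous cen) (hpc : ∀ y, pr (cen y) = y) (hD0 : ∀ t e, t ≤ 0 → D t e = e)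
    (hD1 : ∀ t e, 1 ≤ t → D t e = cen (pr e)) (hDp : ∀ t e, pr (D t e) = pr e) :
    ∃ σ : Y → E, Continuous σ ∧ (∀ y, pr (σ y) = y) ∧ ∀ g y, σ (AY.act g y) = AE.act g (σ y) := by
  classical
  choose b sel hb hb0 hbi hbp hsel using exists_chart AY hfree
  obtain ⟨t, ht⟩ := CompactSpace.elim_nhds_subcover (fun y => {y' | 0 < b y y'})
    (fun y => (isOpen_lt continuous_const (hb y)).mem_nhds (hbp y))
  have key : ∀ s : Finset Y, PSec AE AY pr (fun y => ∑ i ∈ s, b i y) := by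
    intro s
    induction s using Finset.induction_on with
    | empty => exact ⟨cen, by simp⟩
    | insert i s hi ih =>
      have := psec_merge AE AY pr hpa D hD cen hcen hpc hD0 hD1 hDp (fun y => ∑ i ∈ s, b i y) (b i)
        (sel i) (continuous_finsetSum _ fun j _ => hb j) (hb i)
        (fun y => Finset.sum_nonneg fun j _ => hb0 j y) (hb0 i)
        (fun g y => Finset.sum_congr rfl fun j _ => hbi j g y) (hbi i) (hsel i) ih
      simpa only [Finset.sum_insert hi, add_comm] using this
  obtain ⟨σ, hσ⟩ := key t
  have hpos : ∀ y, 0 < ∑ i ∈ t, b i y := by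
    intro y
    have : y ∈ ⋃ x ∈ t, {y' | 0 < b x y'} := ht ▸ trivial
    simp only [Set.mem_iUnion] at this
    obtain ⟨i, hi, h⟩ := this
    exact Finset.sum_pos' (fun j _ => hb0 j y) ⟨i, hi, h⟩
  exact ⟨σ, continuous_iff_continuousAt.2 fun y => (hσ y (hpos y)).2.1,
    fun y => (hσ y (hpos y)).1, fun g y => (hσ y (hpos y)).2.2 g⟩

end Merge
end LensProof

end partd

section parte
namespace LensProof

section Contr
variable {G X Y : Type*} [AddCommGroup G] [Fintype G] [TopologicalSpace X] [MetricSpace Y]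

/-- Mapping path space. -/
abbrev MPath (f : C(X, Y)) : Type _ :=
  {e : X × C(ℝ, Y) // (∀ s ≤ 0, e.2 s = f e.1) ∧ ∀ s, 1 ≤ s → e.2 s = e.2 1}

/-- Action on the path space. -/
def actM (AX : Act G X) (AY : Act G Y) (f : C(X, Y))
    (hf : ∀ g x, f (AX.act g x) = AY.act g (f x)) : Act G (MPath f) where
  act g e := ⟨(AX.act g e.1.1, (⟨AY.act g, AY.cont g⟩ : C(Y, Y)).comp e.1.2), by
    refine ⟨fun s hs => ?_, fun s hs => ?_⟩
    · simp only [ContinuousMap.comp_apply, e.2.1 s hs, ContinuousMap.coe_mk, hf]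
    · simp only [ContinuousMap.comp_apply, e.2.2 s hs, ContinuousMap.coe_mk]⟩
  cont g := by
    refine Continuous.subtype_mk ?_ _
    refine Continuous.prodMk ((AX.cont g).comp (by fun_prop)) ?_
    exact (ContinuousMap.continuous_postcomp _).comp (by fun_prop)
  zero e := by
    apply Subtype.ext
    refine Prod.ext (AX.zero _) ?_
    ext1 s
    exact AY.zero _
  add g h e := by
    apply Subtype.ext
    refine Prod.ext (AX.add _ _ _) ?_
    ext1 s
    exact AY.add _ _ _

variable (f : C(X, Y)) (K : ℝ × X → Y) 

open Classical in
/-- The long path. -/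
noncomputable def del (e : MPath f) (v : ℝ) : Y := if v ≤ 1 then K (v, e.1.1) else e.1.2 (v - 1)

theorem del_cont (hK : Continuous K) (hK1 : ∀ v x, 1 ≤ v → K (v, x) = f x) :
    Continuous fun z : MPath f × ℝ => del f K z.1 z.2 := by
  unfold del
  refine Continuous.if_le ?_ ?_ (by fun_prop) (by fun_prop) ?_
  · exact hK.comp (by fun_prop)
  · fun_prop
  · rintro ⟨e, v⟩ hv
    simp only at hv
    subst hv
    simp only
    rw [hK1 _ _ le_rfl, e.2.1 _ (by norm_num)]

theorem del_two (e : MPath f) (v : ℝ) (hv : 2 ≤ v) : del f K e v = e.1.2 1 := by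
  rw [del, if_neg (by linarith), e.2.2 _ (by linarith)]

/-- clip -/
noncomputable def cp (t : ℝ) : ℝ := max 0 (min t 1)

theorem cp_cont : Continuous cp := by unfold cp; fun_prop
theorem cp0 (t : ℝ) (h : t ≤ 0) : cp t = 0 := by
  unfold cp; exact max_eq_left (by rw [min_le_iff]; left; exact h)
theorem cp1 (t : ℝ) (h : 1 ≤ t) : cp t = 1 := by
  unfold cp; rw [min_eq_right h]; norm_num
theorem cp_mem (t : ℝ) (h : 0 ≤ t) (h' : t ≤ 1) : cp t = t := by
  unfold cp; rw [min_eq_left h', max_eq_right h]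
theorem cp_nonneg (t : ℝ) : 0 ≤ cp t := le_max_left _ _

/-- first reparametrisation -/
noncomputable def VV (t s : ℝ) : ℝ :=
  (1 - cp t) * (1 + cp s) + cp t * max (1 - 2 * cp s) (4 * cp s - 2)

theorem VV_cont : Continuous fun z : ℝ × ℝ => VV z.1 z.2 := by
  have := cp_cont
  unfold VV
  fun_prop

theorem VV0 (t s : ℝ) (h : s ≤ 0) : VV t s = 1 := by
  unfold VV; rw [cp0 s h]; norm_num
theorem VV1 (t s : ℝ) (h : 1 ≤ s) : VV t s = 2 := by
  unfold VV; rw [cp1 s h]; norm_num; ring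

open Classical in
theorem exists_contr (hK : Continuous K) (hK1 : ∀ v x, 1 ≤ v → K (v, x) = f x) (Φ : X ≃ₜ Y)
    (hK0 : ∀ v x, v ≤ 0 → K (v, x) = Φ x) :
    ∃ (D : ℝ → MPath f → MPath f) (cen : Y → MPath f),
      (Continuous fun z : ℝ × MPath f => D z.1 z.2) ∧ Continuous cen ∧
      (∀ y, (cen y).1.2 1 = y) ∧ (∀ t e, t ≤ 0 → D t e = e) ∧
      (∀ t e, 1 ≤ t → D t e = cen (e.1.2 1)) ∧ (∀ t e, (D t e).1.2 1 = e.1.2 1) := by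
  have hdel := del_cont f K hK hK1
  have hVV := VV_cont
  have hcp := cp_cont
  have hKx : ∀ x, K (1, x) = f x := fun x => hK1 _ _ le_rfl
  have hd1 : ∀ e, del f K e 1 = f e.1.1 := fun e => by rw [del, if_pos le_rfl, hKx]
  have hd0 : ∀ e v, v ≤ 0 → del f K e v = Φ e.1.1 := fun e v hv => by
    rw [del, if_pos (by linarith), hK0 _ _ hv]
  -- stage one
  have c1 : Continuous fun z : (ℝ × MPath f) × ℝ => del f K z.1.2 (VV z.1.1 z.2) :=
    hdel.comp (g := fun z : MPath f × ℝ => del f K z.1 z.2) (Continuous.prodMk (continuous_snd.comp continuous_fst)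
      (hVV.comp (by fun_prop : Continuous fun z : (ℝ × MPath f) × ℝ => (z.1.1, z.2))))
  let D1 : ℝ → MPath f → MPath f := fun t e =>
    ⟨(e.1.1, ⟨fun s => del f K e (VV t s), c1.comp (by fun_prop : Continuous fun s => ((t, e), s))⟩),
      by
        refine ⟨fun s hs => ?_, fun s hs => ?_⟩
        · simp only [ContinuousMap.coe_mk, VV0 t s hs, hd1]
        · simp only [ContinuousMap.coe_mk, VV1 t s hs, VV1 t 1 le_rfl]⟩
  have hD1 : Continuous fun z : ℝ × MPath f => D1 z.1 z.2 := by
    refine Continuous.subtype_mk ?_ _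
    refine Continuous.prodMk (by fun_prop) ?_
    exact ContinuousMap.continuous_of_continuous_uncurry _ c1
  -- stage two
  have c2 : Continuous fun z : (ℝ × MPath f) × ℝ => if z.2 ≤ 1 / 2 then
      K (1 - 2 * z.2, Φ.symm (del f K z.1.2 (2 * cp z.1.1))) else
      del f K z.1.2 (max (2 * cp z.1.1) (4 * z.2 - 2)) := by
    have ca : Continuous fun z : (ℝ × MPath f) × ℝ => del f K z.1.2 (2 * cp z.1.1) :=
      hdel.comp (Continuous.prodMk (by fun_prop) (by fun_prop))
    refine Continuous.if_le ?_ ?_ (by fun_prop) (by fun_prop) ?_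
    · exact hK.comp (Continuous.prodMk (by fun_prop) (Φ.symm.continuous.comp ca))
    · exact hdel.comp (Continuous.prodMk (by fun_prop) (by fun_prop))
    · rintro ⟨⟨t, e⟩, s⟩ hs
      simp only at hs ⊢
      subst hs
      rw [hK0 _ _ (by norm_num), Φ.apply_symm_apply, max_eq_left]
      have := cp_nonneg t
      linarith
  let D2 : ℝ → MPath f → MPath f := fun t e =>
    ⟨(Φ.symm (del f K e (2 * cp t)), ⟨fun s => if s ≤ 1 / 2 then
      K (1 - 2 * s, Φ.symm (del f K e (2 * cp t))) else
      del f K e (max (2 * cp t) (4 * s - 2)),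
        c2.comp (by fun_prop : Continuous fun s => ((t, e), s))⟩),
      by
        refine ⟨fun s hs => ?_, fun s hs => ?_⟩
        · simp only [ContinuousMap.coe_mk]
          rw [if_pos (by linarith), hK1 _ _ (by linarith)]
        · simp only [ContinuousMap.coe_mk]
          rw [if_neg (by linarith), if_neg (by norm_num),
            del_two _ _ _ _ (le_trans (by linarith) (le_max_right _ _)),
            del_two _ _ _ _ (le_trans (by norm_num) (le_max_right _ _))]⟩
  have hD2 : Continuous fun z : ℝ × MPath f => D2 z.1 z.2 := by
    refine Continuous.subtype_mk ?_ _
    refine Continuous.prodMk ?_ ?_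
    · exact Φ.symm.continuous.comp
        (hdel.comp (Continuous.prodMk (by fun_prop) (by fun_prop)))
    · exact ContinuousMap.continuous_of_continuous_uncurry _ c2
  have cc : Continuous fun z : Y × ℝ => K (1 - 2 * z.2, Φ.symm z.1) := hK.comp (by fun_prop)
  let cen : Y → MPath f := fun y =>
    ⟨(Φ.symm y, ⟨fun s => K (1 - 2 * s, Φ.symm y),
      cc.comp (by fun_prop : Continuous fun s => (y, s))⟩), by
        refine ⟨fun s hs => ?_, fun s hs => ?_⟩
        · simp only [ContinuousMap.coe_mk]
          rw [hK1 _ _ (by linarith)]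
        · simp only [ContinuousMap.coe_mk]
          rw [hK0 _ _ (by linarith), hK0 _ _ (by norm_num)]⟩
  have hcen : Continuous cen := by
    refine Continuous.subtype_mk ?_ _
    exact Continuous.prodMk (by fun_prop) (ContinuousMap.continuous_of_continuous_uncurry _ cc)
  have e12 : ∀ e, D1 1 e = D2 0 e := by
    intro e
    have hx : Φ.symm (del f K e (2 * cp 0)) = e.1.1 := by
      rw [cp0 0 le_rfl, hd0 _ _ (by norm_num), Φ.symm_apply_apply]
    apply Subtype.ext
    refine Prod.ext hx.symm ?_
    ext1 s
    simp only [D1, D2, ContinuousMap.coe_mk]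
    rw [hx, VV, cp1 1 le_rfl, cp0 0 le_rfl]
    by_cases hs : s ≤ 1 / 2
    · rw [if_pos hs]
      rcases le_total s 0 with h0 | h0
      · rw [cp0 s h0, hK1 _ _ (by linarith)]
        norm_num [hd1]
      · rw [cp_mem s h0 (by linarith), max_eq_left (by linarith)]
        rw [del, if_pos (by linarith)]
        congr 2; ring
    · rw [if_neg hs]
      push Not at hs
      rcases le_total s 1 with h1 | h1
      · rw [cp_mem s (by linarith) h1, max_eq_right (by linarith), max_eq_right (by linarith)]
        congr 1; ring
      · rw [cp1 s h1, del_two _ _ _ _ (by norm_num), del_two]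
        exact le_trans (by linarith) (le_max_right _ _)
  refine ⟨fun t e => if t ≤ 1 / 2 then D1 (2 * t) e else D2 (2 * t - 1) e, cen, ?_, hcen,
    ?_, ?_, ?_, ?_⟩
  · refine Continuous.if_le ?_ ?_ (by fun_prop) (by fun_prop) ?_
    · exact hD1.comp (by fun_prop : Continuous fun z : ℝ × MPath f => (2 * z.1, z.2))
    · exact hD2.comp (by fun_prop : Continuous fun z : ℝ × MPath f => (2 * z.1 - 1, z.2))
    · rintro ⟨t, e⟩ ht
      simp only at ht ⊢
      subst ht
      norm_num [e12]
  · intro y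
    simp only [cen, ContinuousMap.coe_mk]
    rw [hK0 _ _ (by norm_num), Φ.apply_symm_apply]
  · intro t e ht
    simp only
    rw [if_pos (by linarith)]
    apply Subtype.ext
    refine Prod.ext rfl ?_
    ext1 s
    simp only [D1, ContinuousMap.coe_mk, VV]
    rw [cp0 _ (by linarith)]
    have hz : (1 - 0) * (1 + cp s) + 0 * max (1 - 2 * cp s) (4 * cp s - 2) = 1 + cp s := by ring
    rw [hz]
    rcases le_total s 0 with h0 | h0
    · rw [cp0 s h0, add_zero, hd1, e.2.1 _ h0]
    · rcases eq_or_lt_of_le h0 with h0 | h0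
      · subst h0
        rw [cp0 0 le_rfl, add_zero, hd1, e.2.1 _ le_rfl]
      · rcases le_total s 1 with h1 | h1
        · rw [cp_mem s h0.le h1, del, if_neg (by linarith)]
          congr 1; ring
        · rw [cp1 s h1, del_two _ _ _ _ (by norm_num), e.2.2 s h1]
  · intro t e ht
    simp only
    rw [if_neg (by linarith)]
    have h2 : del f K e (2 * cp (2 * t - 1)) = e.1.2 1 := by
      rw [cp1 _ (by linarith), del_two _ _ _ _ (by norm_num)]
    apply Subtype.ext
    refine Prod.ext ?_ ?_
    · simp only [D2, cen]
      rw [h2]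
    · ext1 s
      simp only [D2, cen, ContinuousMap.coe_mk]
      rw [h2, cp1 _ (by linarith)]
      by_cases hs : s ≤ 1 / 2
      · rw [if_pos hs]
      · rw [if_neg hs, del_two _ _ _ _ (le_trans (by norm_num) (le_max_left _ _)),
          hK0 _ _ (by linarith), Φ.apply_symm_apply]
  · intro t e
    simp only
    split_ifs
    · simp only [D1, ContinuousMap.coe_mk]
      rw [VV1 _ 1 le_rfl, del_two _ _ _ _ le_rfl]
    · simp only [D2, ContinuousMap.coe_mk]
      rw [if_neg (by norm_num), del_two _ _ _ _ (le_trans (by norm_num) (le_max_right _ _))]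

theorem rinv [CompactSpace Y] (AX : Act G X) (AY : Act G Y)
    (hfree : ∀ g y, AY.act g y = y → g = 0) (f : C(X, Y))
    (hf : ∀ g x, f (AX.act g x) = AY.act g (f x)) (Φ : X ≃ₜ Y)
    (hΦ : (⟨Φ, Φ.continuous⟩ : C(X, Y)).Homotopic f) :
    ∃ (g : C(Y, X)) (Γ : C(unitInterval × Y, Y)), (∀ k y, g (AY.act k y) = AX.act k (g y)) ∧
      (∀ y, Γ (0, y) = f (g y)) ∧ (∀ y, Γ (1, y) = y) ∧
      ∀ s k y, Γ (s, AY.act k y) = AY.act k (Γ (s, y)) := by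
  obtain ⟨H⟩ := hΦ
  let K : ℝ × X → Y := fun z => H (Set.projIcc 0 1 zero_le_one z.1, z.2)
  have hK : Continuous K := H.continuous.comp
    ((continuous_projIcc.comp continuous_fst).prodMk continuous_snd)
  have hK1 : ∀ v x, 1 ≤ v → K (v, x) = f x := by
    intro v x hv
    simp only [K]
    rw [Set.projIcc_of_right_le _ hv]
    exact H.apply_one x
  have hK0 : ∀ v x, v ≤ 0 → K (v, x) = Φ x := by
    intro v x hv
    simp only [K]
    rw [Set.projIcc_of_le_left _ hv]
    exact H.apply_zero x
  obtain ⟨D, cen, h1, h2, h3, h4, h5, h6⟩ := exists_contr f K hK hK1 Φ hK0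
  obtain ⟨σ, hσ, hp, he⟩ := exists_section (actM AX AY f hf) AY (fun e => e.1.2 1) hfree
    (fun g e => rfl) D h1 cen h2 h3 h4 h5 h6
  refine ⟨⟨fun y => (σ y).1.1, by fun_prop⟩, ⟨fun z => (σ z.2).1.2 z.1, by fun_prop⟩, ?_, ?_, ?_, ?_⟩
  · intro k y
    simp only [ContinuousMap.coe_mk, he]
    rfl
  · intro y
    simp only [ContinuousMap.coe_mk]
    exact (σ y).2.1 _ le_rfl
  · intro y
    exact hp y
  · intro s k y
    simp only [ContinuousMap.coe_mk, he]
    rfl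
end Contr

section Dold
variable {G X Y X' Y' : Type*} [AddCommGroup G] [Fintype G] [MetricSpace X] [MetricSpace Y]
  [TopologicalSpace X'] [TopologicalSpace Y']

theorem desc_map (AX : Act G X) (AY : Act G Y) (πX : X → X') (πY : Y → Y')
    (hX : IsOpenQuotientMap πX) (hY : IsOpenQuotientMap πY)
    (hX' : ∀ x x', πX x = πX x' ↔ ∃ g, x' = AX.act g x)
    (hY' : ∀ x x', πY x = πY x' ↔ ∃ g, x' = AY.act g x)
    (f : C(X, Y)) (hf : ∀ g x, f (AX.act g x) = AY.act g (f x)) :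
    ∃ f' : C(X', Y'), ∀ x, f' (πX x) = πY (f x) := by
  have hq : Topology.IsQuotientMap (⟨πX, hX.continuous⟩ : C(X, X')) := hX.isQuotientMap
  let h : C(X, Y') := ⟨fun x => πY (f x), hY.continuous.comp f.continuous⟩
  have hh : Function.FactorsThrough h (⟨πX, hX.continuous⟩ : C(X, X')) := by
    intro x x' hx
    obtain ⟨g, rfl⟩ := (hX' x x').1 hx
    exact (hY' _ _).2 ⟨g, hf g x⟩
  refine ⟨hq.lift h hh, fun x => ?_⟩
  have := congrArg (fun k : C(X, Y') => k x) (hq.lift_comp h hh)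
  exact this

theorem desc_homotopy (AX : Act G X) (AY : Act G Y) (πX : X → X') (πY : Y → Y')
    (hX : IsOpenQuotientMap πX) (hY : IsOpenQuotientMap πY)
    (hX' : ∀ x x', πX x = πX x' ↔ ∃ g, x' = AX.act g x)
    (hY' : ∀ x x', πY x = πY x' ↔ ∃ g, x' = AY.act g x)
    (Γ : C(unitInterval × X, Y)) (hf : ∀ s g x, Γ (s, AX.act g x) = AY.act g (Γ (s, x)))
    (f g : C(X', Y')) (h0 : ∀ x, f (πX x) = πY (Γ (0, x))) (h1 : ∀ x, g (πX x) = πY (Γ (1, x))) :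
    f.Homotopic g := by
  have ho : IsOpenQuotientMap (Prod.map id πX : unitInterval × X → unitInterval × X') :=
    IsOpenQuotientMap.id.prodMap hX
  have hq : Topology.IsQuotientMap
    (⟨Prod.map id πX, ho.continuous⟩ : C(unitInterval × X, unitInterval × X')) := ho.isQuotientMap
  let h : C(unitInterval × X, Y') := ⟨fun x => πY (Γ x), hY.continuous.comp Γ.continuous⟩
  have hh : Function.FactorsThrough h
      (⟨Prod.map id πX, ho.continuous⟩ : C(unitInterval × X, unitInterval × X')) := by
    rintro ⟨s, x⟩ ⟨s', x'⟩ hx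
    have hx1 : s = s' := congrArg Prod.fst hx
    have hx2 : πX x = πX x' := congrArg Prod.snd hx
    subst hx1
    obtain ⟨g, rfl⟩ := (hX' x x').1 hx2
    exact (hY' _ _).2 ⟨g, hf s g x⟩
  have key : ∀ s x, hq.lift h hh (s, πX x) = πY (Γ (s, x)) := fun s x =>
    congrArg (fun k : C(unitInterval × X, Y') => k (s, x)) (hq.lift_comp h hh)
  refine ⟨⟨hq.lift h hh, ?_, ?_⟩⟩
  · intro x
    obtain ⟨x, rfl⟩ := hX.surjective x
    exact (key 0 x).trans (h0 x).symm
  · intro x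
    obtain ⟨x, rfl⟩ := hX.surjective x
    exact (key 1 x).trans (h1 x).symm

theorem dold [CompactSpace X] [CompactSpace Y] (AX : Act G X) (AY : Act G Y)
    (hfreeX : ∀ g x, AX.act g x = x → g = 0) (hfreeY : ∀ g y, AY.act g y = y → g = 0)
    (πX : X → X') (πY : Y → Y')
    (hX : IsOpenQuotientMap πX) (hY : IsOpenQuotientMap πY)
    (hX' : ∀ x x', πX x = πX x' ↔ ∃ g, x' = AX.act g x)
    (hY' : ∀ x x', πY x = πY x' ↔ ∃ g, x' = AY.act g x)
    (f : C(X, Y)) (hf : ∀ g x, f (AX.act g x) = AY.act g (f x)) (Φ : X ≃ₜ Y)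
    (hΦ : (⟨Φ, Φ.continuous⟩ : C(X, Y)).Homotopic f) :
    Nonempty (ContinuousMap.HomotopyEquiv X' Y') := by
  obtain ⟨g, Γ, hg, hΓ0, hΓ1, hΓ⟩ := rinv AX AY hfreeY f hf Φ hΦ
  have hgψ : (⟨Φ.symm, Φ.symm.continuous⟩ : C(Y, X)).Homotopic g := by
    let φ : C(X, Y) := ⟨Φ, Φ.continuous⟩
    let ψ : C(Y, X) := ⟨Φ.symm, Φ.symm.continuous⟩
    have a1 : (f.comp g).Homotopic (ContinuousMap.id Y) := ⟨⟨Γ, hΓ0, hΓ1⟩⟩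
    have a2 : (φ.comp g).Homotopic (f.comp g) := hΦ.comp (ContinuousMap.Homotopic.refl g)
    have a3 : (ψ.comp (φ.comp g)).Homotopic (ψ.comp (ContinuousMap.id Y)) :=
      (ContinuousMap.Homotopic.refl ψ).comp (a2.trans a1)
    have e1 : ψ.comp (φ.comp g) = g := by
      ext1 y
      exact Φ.symm_apply_apply _
    rw [e1] at a3
    exact a3.symm
  obtain ⟨f₁, Γ₁, hf₁, hΔ0, hΔ1, hΔ⟩ := rinv AY AX hfreeX g hg Φ.symm hgψ
  obtain ⟨F, hF⟩ := desc_map AX AY πX πY hX hY hX' hY' f hf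
  obtain ⟨F₁, hF₁⟩ := desc_map AX AY πX πY hX hY hX' hY' f₁ hf₁
  obtain ⟨g', hg'⟩ := desc_map AY AX πY πX hY hX hY' hX' g hg
  have h1 : (F.comp g').Homotopic (ContinuousMap.id Y') := by
    refine desc_homotopy AY AY πY πY hY hY hY' hY' Γ hΓ _ _ ?_ ?_
    · intro y; simp [hg', hF, hΓ0]
    · intro y; simp [hΓ1]
  have h2 : (g'.comp F₁).Homotopic (ContinuousMap.id X') := by
    refine desc_homotopy AX AX πX πX hX hX hX' hX' Γ₁ hΔ _ _ ?_ ?_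
    · intro y; simp [hg', hF₁, hΔ0]
    · intro y; simp [hΔ1]
  have h3 : F.Homotopic F₁ := by
    have a1 : (F.comp (g'.comp F₁)).Homotopic F :=
      (ContinuousMap.Homotopic.refl F).comp h2
    have a2 : ((F.comp g').comp F₁).Homotopic F₁ := h1.comp (ContinuousMap.Homotopic.refl F₁)
    exact a1.symm.trans a2
  have h4 : (g'.comp F).Homotopic (ContinuousMap.id X') :=
    ((ContinuousMap.Homotopic.refl g').comp h3).trans h2
  exact ⟨⟨F, g', h4, h1⟩⟩

end Dold
end LensProof

end parte

section partf
open ComplexConjugate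

namespace LensProof
variable {p : ℕ} [hp : Fact p.Prime]

/-- root of unity -/
noncomputable def ee (k : ZMod p) : ℂ := ZMod.stdAddChar (N := p) k

theorem ee_eq (k : ZMod p) :
    ee k = Complex.exp (2 * Real.pi * Complex.I * ((k.val : ℕ) : ℂ) / p) := by
  rw [ee, ZMod.stdAddChar_apply, ZMod.toCircle_apply]

theorem ee_add (a b : ZMod p) : ee (a + b) = ee a * ee b := AddChar.map_add_eq_mul _ _ _
theorem ee_zero : ee (0 : ZMod p) = 1 := AddChar.map_zero_eq_one _
theorem ee_norm (a : ZMod p) : ‖ee a‖ = 1 := by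
  rw [ee, ZMod.stdAddChar_apply]; exact Circle.norm_coe _
theorem ee_ne (a : ZMod p) : ee a ≠ 0 := by
  intro h
  have := ee_norm a
  rw [h] at this
  simp at this
theorem ee_one_iff (a : ZMod p) (h : ee a = 1) : a = 0 := by
  apply ZMod.injective_stdAddChar (N := p)
  rw [AddChar.map_zero_eq_one]
  exact h
theorem ee_nsmul (n : ℕ) (a : ZMod p) : ee ((n : ZMod p) * a) = ee a ^ n := by
  rw [← nsmul_eq_mul]
  exact AddChar.map_nsmul_eq_pow _ _ _
theorem ee_neg_mul (a : ZMod p) : ee (-a) * ee a = 1 := by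
  rw [← ee_add, neg_add_cancel, ee_zero]
theorem ee_conj (a : ZMod p) : conj (ee a) = ee (-a) := by
  have h1 : conj (ee a) * ee a = 1 := by
    rw [conj_mul_self', Complex.normSq_eq_norm_sq, ee_norm]; simp
  exact mul_right_cancel₀ (ee_ne a) (h1.trans (ee_neg_mul a).symm)

/-- rotation -/
noncomputable def rot (u v : ZMod p) (x : Sphere3) : Sphere3 :=
  ⟨(ee u * x.1.1, ee v * x.1.2), by simp [ee_norm, x.2]⟩

theorem rot_val (u v : ZMod p) (x : Sphere3) : (rot u v x).1 = (ee u * x.1.1, ee v * x.1.2) := rfl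

theorem rot_cont (u v : ZMod p) : Continuous (rot u v) := by
  refine Continuous.subtype_mk ?_ _
  fun_prop

theorem rot_zero (x : Sphere3) : rot (0 : ZMod p) 0 x = x := by
  apply Subtype.ext
  simp [rot_val, ee_zero]

theorem rot_add (u v u' v' : ZMod p) (x : Sphere3) :
    rot (u + u') (v + v') x = rot u v (rot u' v' x) := by
  apply Subtype.ext
  simp [rot_val, ee_add, mul_assoc]

theorem rot_fix (u v : ZMod p) (x : Sphere3) (h : rot u v x = x) : u = 0 ∨ v = 0 := by
  have h' := congrArg Subtype.val h
  rw [rot_val] at h'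
  have h1 := congrArg Prod.fst h'
  have h2 := congrArg Prod.snd h'
  simp only at h1 h2
  rcases not_and_or.1 (sphere_ne x) with hx | hx
  · left
    exact ee_one_iff u (mul_right_cancel₀ hx (by rw [h1, one_mul]))
  · right
    exact ee_one_iff v (mul_right_cancel₀ hx (by rw [h2, one_mul]))

/-- linear action -/
noncomputable def actL (c d : ZMod p) : Act (ZMod p) Sphere3 where
  act k := rot (k * c) (k * d)
  cont k := rot_cont _ _
  zero x := by rw [zero_mul, zero_mul, rot_zero]
  add k l x := by rw [add_mul, add_mul, rot_add]

theorem actL_free (c d : ZMod p) (hc : c ≠ 0) (hd : d ≠ 0) (k : ZMod p) (x : Sphere3)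
    (h : (actL c d).act k x = x) : k = 0 := by
  rcases rot_fix _ _ x h with h | h
  · exact (mul_eq_zero.1 h).resolve_right hc
  · exact (mul_eq_zero.1 h).resolve_right hd

theorem lensRel_iff (r : ZMod p) (x y : Sphere3) :
    lensRel p r x y ↔ ∃ k : ZMod p, y = (actL 1 r).act k x := by
  unfold lensRel
  refine exists_congr fun k => ?_
  rw [Subtype.ext_iff]
  change _ ↔ y.1 = (ee (k * 1) * x.1.1, ee (k * r) * x.1.2)
  rw [mul_one, ee_eq, ee_eq]

theorem lens_mk_eq (r : ZMod p) (x y : Sphere3) :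
    Quot.mk (lensRel p r) x = Quot.mk (lensRel p r) y ↔ ∃ k : ZMod p, y = (actL 1 r).act k x := by
  rw [← lensRel_iff]
  refine Equivalence.quot_mk_eq_iff ⟨?_, ?_, ?_⟩ x y
  · intro x
    rw [lensRel_iff]
    exact ⟨0, ((actL 1 r).zero x).symm⟩
  · intro x y h
    rw [lensRel_iff] at *
    obtain ⟨k, rfl⟩ := h
    exact ⟨-k, ((actL 1 r).neg_act k x).symm⟩
  · intro x y z h h'
    rw [lensRel_iff] at *
    obtain ⟨k, rfl⟩ := h
    obtain ⟨l, rfl⟩ := h'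
    exact ⟨l + k, ((actL 1 r).add l k x).symm⟩

/-- the action presents the lens space -/
def Presents (c d q : ZMod p) : Prop := ∃ π : Sphere3 → Lens p q, IsOpenQuotientMap π ∧
  ∀ x x', π x = π x' ↔ ∃ k, x' = (actL c d).act k x

theorem lens_mk_open (r : ZMod p) :
    IsOpenQuotientMap (Quot.mk (lensRel p r) : Sphere3 → Lens p r) := by
  refine ⟨Quot.mk_surjective, continuous_quot_mk, fun U hU => ?_⟩
  rw [← isQuotientMap_quot_mk.isOpen_preimage]
  have : Quot.mk (lensRel p r) ⁻¹' (Quot.mk (lensRel p r) '' U) =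
      ⋃ k : ZMod p, (actL 1 r).act k ⁻¹' U := by
    ext x
    simp only [Set.mem_preimage, Set.mem_image, Set.mem_iUnion]
    constructor
    · rintro ⟨y, hy, h⟩
      obtain ⟨k, rfl⟩ := (lens_mk_eq r x y).1 h.symm
      exact ⟨k, hy⟩
    · rintro ⟨k, hk⟩
      exact ⟨_, hk, ((lens_mk_eq r x _).2 ⟨k, rfl⟩).symm⟩
  rw [this]
  exact isOpen_iUnion fun k => hU.preimage ((actL 1 r).cont k)

theorem presents_pos (c q : ZMod p) (hc : c ≠ 0) : Presents c (c * q) q := by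
  refine ⟨Quot.mk _, lens_mk_open q, fun x x' => ?_⟩
  rw [lens_mk_eq]
  constructor
  · rintro ⟨k, rfl⟩
    refine ⟨k * c⁻¹, ?_⟩
    change rot _ _ x = rot _ _ x
    congr 1
    · field_simp
    · field_simp
  · rintro ⟨k, rfl⟩
    refine ⟨k * c, ?_⟩
    change rot _ _ x = rot _ _ x
    congr 1
    · ring
    · ring

/-- conjugation of second coordinate -/
noncomputable def cj : Sphere3 ≃ₜ Sphere3 where
  toFun x := ⟨(x.1.1, conj x.1.2), by simpa using x.2⟩
  invFun x := ⟨(x.1.1, conj x.1.2), by simpa using x.2⟩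
  left_inv x := by simp
  right_inv x := by simp
  continuous_toFun := by
    have := hc_conj
    refine Continuous.subtype_mk ?_ _
    fun_prop
  continuous_invFun := by
    have := hc_conj
    refine Continuous.subtype_mk ?_ _
    fun_prop

theorem cj_rot (u v : ZMod p) (x : Sphere3) : cj (rot u v x) = rot u (-v) (cj x) := by
  apply Subtype.ext
  change (ee u * x.1.1, conj (ee v * x.1.2)) = (ee u * x.1.1, ee (-v) * conj x.1.2)
  rw [map_mul, ee_conj]

theorem presents_neg (c q : ZMod p) (hc : c ≠ 0) : Presents c (-(c * q)) q := by
  obtain ⟨π, h1, h2⟩ := presents_pos c q hc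
  refine ⟨π ∘ cj, h1.comp cj.isOpenQuotientMap, fun x x' => ?_⟩
  change π (cj x) = π (cj x') ↔ _
  rw [h2]
  refine exists_congr fun k => ?_
  have : (actL c (c * q)).act k (cj x) = cj ((actL c (-(c * q))).act k x) := by
    change rot _ _ (cj x) = cj (rot _ _ x)
    rw [cj_rot]
    congr 1
    ring
  rw [this, cj.injective.eq_iff]

theorem presents_of (c d q : ZMod p) (hc : c ≠ 0) (h : d = c * q ∨ d = -(c * q)) :
    Presents c d q := by
  rcases h with rfl | rfl
  · exact presents_pos c q hc
  · exact presents_neg c q hc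

/-- product action -/
def Act.prod {G H X Y : Type*} [AddCommGroup G] [AddCommGroup H] [TopologicalSpace X]
    [TopologicalSpace Y] (A : Act G X) (B : Act H Y) : Act (G × H) (X × Y) where
  act g z := (A.act g.1 z.1, B.act g.2 z.2)
  cont g := ((A.cont _).comp continuous_fst).prodMk ((B.cont _).comp continuous_snd)
  zero z := by simp [A.zero, B.zero]
  add g h z := by simp [A.add, B.add]

theorem pow_ne (m n : ℕ) (x : Sphere3) : ¬ ((co1 ^ m) x = 0 ∧ (co2 ^ n) x = 0) := by
  rintro ⟨h1, h2⟩
  simp only [ContinuousMap.pow_apply] at h1 h2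
  exact sphere_ne x ⟨pow_eq_zero_iff_of_pos_aux h1, pow_eq_zero_iff_of_pos_aux h2⟩
where
  pow_eq_zero_iff_of_pos_aux {a : ℂ} {n : ℕ} (h : a ^ n = 0) : a = 0 := eq_zero_of_pow_eq_zero h

/-- power map -/
noncomputable def Pw (m n : ℕ) : C(Sphere3, Sphere3) := sym (co1 ^ m) (co2 ^ n) (pow_ne m n)

theorem nz_rot (u v : ZMod p) (C D : ℂ) (h h') : nz (ee u * C) (ee v * D) h' = rot u v (nz C D h) := by
  apply Subtype.ext
  simp only [nz, rot_val, norm_mul, ee_norm, one_mul]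
  apply Prod.ext <;> simp <;> ring

theorem Pw_rot (m n : ℕ) (u v : ZMod p) (x : Sphere3) :
    Pw m n (rot u v x) = rot ((m : ZMod p) * u) ((n : ZMod p) * v) (Pw m n x) := by
  have h' : ¬ (ee ((m : ZMod p) * u) * (co1 ^ m) x = 0 ∧ ee ((n : ZMod p) * v) * (co2 ^ n) x = 0) := by
    simp only [mul_eq_zero, ee_ne, false_or]
    exact pow_ne m n x
  have := nz_rot ((m : ZMod p) * u) ((n : ZMod p) * v) ((co1 ^ m) x) ((co2 ^ n) x) (pow_ne m n x) h'
  change _ = rot ((m : ZMod p) * u) ((n : ZMod p) * v) (nz _ _ (pow_ne m n x))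
  rw [← this]
  refine nz_congr (pow_ne m n _) h' ?_ ?_
  · rw [ee_nsmul]
    change (ee u * x.1.1) ^ m = _ * x.1.1 ^ m
    rw [mul_pow]
  · rw [ee_nsmul]
    change (ee v * x.1.2) ^ n = _ * x.1.2 ^ n
    rw [mul_pow]

theorem rot_mul (a b : ZMod p) (A B : Sphere3) :
    rot a b A * rot 0 (a + b) B = rot a b (A * B) := by
  apply Subtype.ext
  simp only [mul_val, rot_val, map_mul, ee_conj, ee_add, ee_zero]
  have h1 := ee_neg_mul a
  have h2 := ee_neg_mul b
  apply Prod.ext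
  · simp only
    linear_combination (-(ee a * conj A.1.2 * B.1.2)) * h2
  · simp only
    linear_combination (ee b * conj A.1.1 * B.1.2) * h1

/-- automorphism -/
noncomputable def rotHom (w : ZMod p) : Sphere3 →* Sphere3 where
  toFun := rot 0 w
  map_one' := by apply Subtype.ext; simp [rot_val, one_val, ee_zero]
  map_mul' A B := by
    have := rot_mul 0 w A B
    rw [zero_add] at this
    exact this.symm

theorem rot_zpow (w : ZMod p) (A : Sphere3) (k : ℤ) : rot 0 w A ^ k = rot 0 w (A ^ k) :=
  (map_zpow (rotHom w) A k).symm

theorem cl_Pw {X : Type*} [TopologicalSpace X] (m n : ℕ) (k : C(X, Sphere3)) :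
    cl ((Pw m n).comp k) = cl k ^ (m * n) := by
  have h1 : cl (Pw m n) = cl ((ContinuousMap.id Sphere3) ^ (m * n)) := by
    have hne : ∀ x, ¬ (co1 x = 0 ∧ co2 x = 0) := sphere_ne
    rw [Pw, sym_pow co1 co2 m n hne, sym_co]; rfl
  rw [cl_comp_congr h1]
  rfl

end LensProof

end partf

section partg
namespace LensProof
variable {p : ℕ} [hp : Fact p.Prime]

theorem nt_inv (M : ℕ) (hM : 0 < M) (n : ℕ) (h : Nat.Coprime n M) :
    ∃ (m : ℕ) (k : ℤ), (m : ℤ) * n + M * k = 1 := by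
  have : NeZero M := ⟨hM.ne'⟩
  refine ⟨((n : ZMod M)⁻¹).val, ?_⟩
  have h1 : (((((n : ZMod M)⁻¹).val : ℤ) * n : ℤ) : ZMod M) = ((1 : ℤ) : ZMod M) := by
    push_cast
    rw [ZMod.natCast_zmod_val, mul_comm, ZMod.coe_mul_inv_eq_one n h]
  rw [ZMod.intCast_eq_intCast_iff_dvd_sub] at h1
  obtain ⟨k, hk⟩ := h1
  exact ⟨k, by linarith⟩

theorem nt_single (u : ZMod p) (hu : u ≠ 0) (M : ℕ) (hM : 0 < M) (hpM : p ∣ M) :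
    ∃ (m n : ℕ) (k : ℤ), (n : ZMod p) = u ∧ (m : ZMod p) * u = 1 ∧ (m : ℤ) * n + M * k = 1 := by
  obtain ⟨n, hn, hpr, hu'⟩ := Nat.forall_exists_prime_gt_and_eq_mod (q := p) (a := u)
    (isUnit_iff_ne_zero.2 hu) M
  have hc : Nat.Coprime n M := Nat.coprime_of_lt_prime hM.ne' hn hpr
  obtain ⟨m, k, h⟩ := nt_inv M hM n hc
  refine ⟨m, n, k, hu', ?_, h⟩
  have := congrArg (Int.cast : ℤ → ZMod p) h
  push_cast at this
  rw [(ZMod.natCast_eq_zero_iff M p).2 hpM, hu'] at this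
  simpa using this

theorem single (r q c : ZMod p) (hr : r ≠ 0) (hq : q ≠ 0) (hc : c ≠ 0)
    (h : q * c ^ 2 = r ∨ q * c ^ 2 = -r) :
    Nonempty (ContinuousMap.HomotopyEquiv (Lens p r) (Lens p q)) := by
  set d : ZMod p := r * c⁻¹ with hd
  have hd0 : d ≠ 0 := mul_ne_zero hr (inv_ne_zero hc)
  have hp1 : Presents c d q := by
    refine presents_of c d q hc ?_
    rcases h with h | h
    · left; rw [hd, ← h]; field_simp
    · right; rw [hd, ← neg_eq_iff_eq_neg.2 h]; field_simp
  have hp2 : Presents 1 r r := presents_of 1 r r one_ne_zero (Or.inl (one_mul r).symm)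
  obtain ⟨πX, hX, hX'⟩ := hp2
  obtain ⟨πY, hY, hY'⟩ := hp1
  let n' : ℕ := ((c + d) * r⁻¹).val + p
  have hn' : (n' : ZMod p) * r = c + d := by
    simp only [n']
    push_cast
    rw [ZMod.natCast_zmod_val]
    simp
    field_simp
  have hp0 : 0 < p := hp.out.pos
  obtain ⟨m, n, k, h1, h2, h3⟩ := nt_single (p := p) c⁻¹ (inv_ne_zero hc) (p * n')
    (by positivity) (dvd_mul_right _ _)
  have hm : (m : ZMod p) = c := by
    have := congrArg (· * c) h2
    simpa [mul_assoc, hc] using this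
  let f : C(Sphere3, Sphere3) := Pw m n * (Pw p n') ^ k
  refine dold (actL 1 r) (actL c d) (actL_free 1 r one_ne_zero hr) (actL_free c d hc hd0) πX πY hX hY
    hX' hY' f ?_ (Homeomorph.refl _) ?_
  · intro g x
    change Pw m n (rot (g * 1) (g * r) x) * (Pw p n' (rot (g * 1) (g * r) x)) ^ k =
      rot (g * c) (g * d) (Pw m n x * (Pw p n' x) ^ k)
    rw [Pw_rot, Pw_rot, hm, h1]
    have a1 : c*(g*1) = g*c := by ring
    have a2 : c⁻¹*(g*r) = g*d := by rw [hd]; ring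
    have a3 : (p:ZMod p)*(g*1) = 0 := by simp
    have a4 : (n':ZMod p)*(g*r) = g*c+g*d := by linear_combination g*hn'
    rw [a1,a2,a3,a4, rot_zpow, rot_mul]
  · rw [← cl_eq]
    change cl (ContinuousMap.id Sphere3) = _
    have e1 := cl_Pw m n (ContinuousMap.id Sphere3)
    have e2 := cl_Pw p n' (ContinuousMap.id Sphere3)
    rw [ContinuousMap.comp_id] at e1 e2
    simp only [f]
    rw [cl_mul, cl_zpow, e1, e2, ← zpow_natCast, ← zpow_natCast, ← zpow_mul, ← zpow_add]
    push_cast at h3 ⊢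
    rw [h3, zpow_one]

section gen
variable {S : Type*} [Group S] [TopologicalSpace S] [IsTopologicalGroup S]

/-- shear homeomorphism -/
noncomputable def shearR (b : ℤ) : (S × S) ≃ₜ (S × S) where
  toFun z := (z.1, z.2 * z.1 ^ b)
  invFun z := (z.1, z.2 * z.1 ^ (-b))
  left_inv z := by simp
  right_inv z := by simp
  continuous_toFun := by fun_prop
  continuous_invFun := by fun_prop

/-- shear homeomorphism -/
noncomputable def shearL (b : ℤ) : (S × S) ≃ₜ (S × S) where
  toFun z := (z.1 * z.2 ^ b, z.2)
  invFun z := (z.1 * z.2 ^ (-b), z.2)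
  left_inv z := by simp
  right_inv z := by simp
  continuous_toFun := by fun_prop
  continuous_invFun := by fun_prop

theorem conj_word {Γ : Type*} [Group Γ] (x y : Γ) (i j : ℤ) (t : Γ) :
    (t * x * t⁻¹) ^ i * (t * y * t⁻¹) ^ j = t * (x ^ i * y ^ j) * t⁻¹ := by
  rw [conj_zpow, conj_zpow]; group

/-- inner homeomorphism -/
noncomputable def inner (i j : ℤ) : (S × S) ≃ₜ (S × S) where
  toFun z := ((z.1 ^ i * z.2 ^ j) * z.1 * (z.1 ^ i * z.2 ^ j)⁻¹,
    (z.1 ^ i * z.2 ^ j) * z.2 * (z.1 ^ i * z.2 ^ j)⁻¹)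
  invFun z := ((z.1 ^ i * z.2 ^ j)⁻¹ * z.1 * (z.1 ^ i * z.2 ^ j),
    (z.1 ^ i * z.2 ^ j)⁻¹ * z.2 * (z.1 ^ i * z.2 ^ j))
  left_inv z := by
    simp only [conj_word]
    apply Prod.ext <;> simp only <;> group
  right_inv z := by
    have h := conj_word z.1 z.2 i j (z.1 ^ i * z.2 ^ j)⁻¹
    rw [inv_inv] at h
    simp only [h]
    apply Prod.ext <;> simp only <;> group
  continuous_toFun := by fun_prop
  continuous_invFun := by fun_prop

/-- total homeomorphism -/
noncomputable def tot (a b d i j : ℤ) : (S × S) ≃ₜ (S × S) :=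
  (inner i j).trans ((shearR d).trans ((shearL 1).trans ((shearR b).trans (shearL a))))

theorem tot_apply (a b d i j : ℤ) (u v : S) : tot a b d i j (u, v) =
    ((u ^ i * v ^ j) * ((u * (v * u ^ d) ^ (1 : ℤ)) *
      ((v * u ^ d) * (u * (v * u ^ d) ^ (1 : ℤ)) ^ b) ^ a) * (u ^ i * v ^ j)⁻¹,
     (u ^ i * v ^ j) * ((v * u ^ d) * (u * (v * u ^ d) ^ (1 : ℤ)) ^ b) * (u ^ i * v ^ j)⁻¹) := by
  generalize ht : u ^ i * v ^ j = t
  have hin : inner i j (u, v) = (t * u * t⁻¹, t * v * t⁻¹) := by subst ht; rfl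
  have key : ∀ w, t * w * t⁻¹ = MulAut.conj t w := fun w => rfl
  have : tot a b d i j (u, v) =
    shearL a (shearR b (shearL 1 (shearR d (inner i j (u, v))))) := rfl
  rw [this, hin]
  simp only [key, map_mul, map_zpow]
  rfl

theorem tot_fst (a b d i j : ℤ) (x y : C(S × S, S)) (hx : x = ContinuousMap.fst)
    (hy : y = ContinuousMap.snd) :
    ContinuousMap.fst.comp (⟨tot a b d i j, (tot a b d i j).continuous⟩ : C(S × S, S × S)) =
    (x ^ i * y ^ j) * ((x * (y * x ^ d) ^ (1 : ℤ)) *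
      ((y * x ^ d) * (x * (y * x ^ d) ^ (1 : ℤ)) ^ b) ^ a) * (x ^ i * y ^ j)⁻¹ := by
  subst hx hy
  ext1 z
  obtain ⟨u, v⟩ := z
  exact congrArg Prod.fst (tot_apply a b d i j u v)

theorem tot_snd (a b d i j : ℤ) (x y : C(S × S, S)) (hx : x = ContinuousMap.fst)
    (hy : y = ContinuousMap.snd) :
    ContinuousMap.snd.comp (⟨tot a b d i j, (tot a b d i j).continuous⟩ : C(S × S, S × S)) =
    (x ^ i * y ^ j) * ((y * x ^ d) * (x * (y * x ^ d) ^ (1 : ℤ)) ^ b) * (x ^ i * y ^ j)⁻¹ := by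
  subst hx hy
  ext1 z
  obtain ⟨u, v⟩ := z
  exact congrArg Prod.snd (tot_apply a b d i j u v)

end gen

theorem presents_prod {c d q c' d' q' : ZMod p} (h : Presents c d q) (h' : Presents c' d' q') :
    ∃ π : Sphere3 × Sphere3 → Lens p q × Lens p q', IsOpenQuotientMap π ∧
      ∀ x x', π x = π x' ↔ ∃ k, x' = ((actL c d).prod (actL c' d')).act k x := by
  obtain ⟨π, h1, h2⟩ := h
  obtain ⟨π', h1', h2'⟩ := h'
  refine ⟨Prod.map π π', h1.prodMap h1', fun x x' => ?_⟩
  rw [Prod.ext_iff]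
  change π x.1 = π x'.1 ∧ π' x.2 = π' x'.2 ↔ _
  rw [h2, h2']
  constructor
  · rintro ⟨⟨k, hk⟩, ⟨l, hl⟩⟩
    exact ⟨(k, l), Prod.ext hk hl⟩
  · rintro ⟨k, rfl⟩
    exact ⟨⟨k.1, rfl⟩, ⟨k.2, rfl⟩⟩

theorem prod_free (c d c' d' : ZMod p) (hc : c ≠ 0) (hd : d ≠ 0) (hc' : c' ≠ 0) (hd' : d' ≠ 0)
    (k : ZMod p × ZMod p) (x : Sphere3 × Sphere3)
    (h : ((actL c d).prod (actL c' d')).act k x = x) : k = 0 := by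
  have h1 := congrArg Prod.fst h
  have h2 := congrArg Prod.snd h
  exact Prod.ext (actL_free c d hc hd _ _ h1) (actL_free c' d' hc' hd' _ _ h2)

theorem exists_homeo (a b d : ℤ) : ∃ Φ : (Sphere3 × Sphere3) ≃ₜ (Sphere3 × Sphere3),
    cl (ContinuousMap.fst.comp (⟨Φ, Φ.continuous⟩ : C(Sphere3 × Sphere3, Sphere3 × Sphere3))) =
      cl ContinuousMap.fst ^ (1 + d + a * (d + b * (1 + d))) *
        cl ContinuousMap.snd ^ (1 + a * (1 + b)) ∧
    cl (ContinuousMap.snd.comp (⟨Φ, Φ.continuous⟩ : C(Sphere3 × Sphere3, Sphere3 × Sphere3))) =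
      cl ContinuousMap.snd ^ (1 + b) * cl ContinuousMap.fst ^ (d + b * (1 + d)) := by
  set x : Gam (Sphere3 × Sphere3) := cl ContinuousMap.fst with hx
  set y : Gam (Sphere3 × Sphere3) := cl ContinuousMap.snd with hy
  set c := x * y * x⁻¹ * y⁻¹ with hc
  have cx : Commute x c := nil2 x y
  have cy : Commute y c := by
    have := (nil2 y x).inv_right
    have e : (y * x * y⁻¹ * x⁻¹)⁻¹ = c := by rw [hc]; group
    rwa [e] at this
  have nx : NF x y c x 1 0 := ⟨0, by simp⟩
  have ny : NF x y c y 0 1 := ⟨0, by simp⟩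
  have ny1 := ny.mul hc cx cy (nx.zpow hc cx cy d)
  have nx2 := nx.mul hc cx cy (ny1.zpow hc cx cy 1)
  have ny2 := ny1.mul hc cx cy (nx2.zpow hc cx cy b)
  have nx3 := nx2.mul hc cx cy (ny2.zpow hc cx cy a)
  obtain ⟨i, j, h1, h2⟩ := alg_main hc cx cy nx3 ny2 (by ring)
  refine ⟨tot a b d i j, ?_, ?_⟩
  · have e1 : 1 + 1 * (0 + d * 1) + a * (0 + d * 1 + b * (1 + 1 * (0 + d * 1)))
      = 1 + d + a * (d + b * (1 + d)) := by ring
    have e2 : 0 + 1 * (1 + d * 0) + a * (1 + d * 0 + b * (0 + 1 * (1 + d * 0)))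
      = 1 + a * (1 + b) := by ring
    rw [e1, e2] at h1
    rw [← h1, tot_fst a b d i j _ _ rfl rfl, hx, hy]
    simp only [cl_mul, cl_zpow, cl_inv]
  · have e1 : 0 + d * 1 + b * (1 + 1 * (0 + d * 1)) = d + b * (1 + d) := by ring
    have e2 : 1 + d * 0 + b * (0 + 1 * (1 + d * 0)) = 1 + b := by ring
    rw [e1, e2] at h2
    rw [← h2, tot_snd a b d i j _ _ rfl rfl, hx, hy]
    simp only [cl_mul, cl_zpow, cl_inv]

end LensProof

end partg

section parth
namespace LensProof
variable {p : ℕ} [hp : Fact p.Prime]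

theorem val_coprime (u : ZMod p) (hu : u ≠ 0) : Nat.Coprime u.val (p * p) := by
  have h : Nat.Coprime u.val p := by
    refine (Nat.coprime_of_lt_prime ?_ (ZMod.val_lt u) hp.out).symm
    rwa [Ne, ZMod.val_eq_zero]
  exact h.mul_right h

theorem prod_main (r₁ r₂ r₂' c : ZMod p) (h1 : r₁ ≠ 0) (h2 : r₂' ≠ 0) (hc : c ≠ 0)
    (hr : r₂' = r₂ ∨ r₂' = -r₂) (h : r₁ * r₂' = c ^ 2) :
    Nonempty (ContinuousMap.HomotopyEquiv (Lens p r₁ × Lens p r₂)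
      (Lens p (1 : ZMod p) × Lens p (1 : ZMod p))) := by
  have pa : Presents 1 r₁ r₁ := presents_of 1 r₁ r₁ one_ne_zero (Or.inl (one_mul _).symm)
  have pb : Presents 1 r₂' r₂ := presents_of 1 r₂' r₂ one_ne_zero (by simpa using hr)
  have pc : Presents c (-c) 1 := presents_of c (-c) 1 hc (by simp)
  have pd : Presents (p := p) 1 (-1) 1 := presents_of 1 (-1) 1 one_ne_zero (by simp)
  obtain ⟨πX, hX, hX'⟩ := presents_prod pa pb
  obtain ⟨πY, hY, hY'⟩ := presents_prod pc pd
  have u1 : -c * r₁⁻¹ ≠ 0 := mul_ne_zero (neg_ne_zero.2 hc) (inv_ne_zero h1)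
  have u2 : -(r₂')⁻¹ ≠ 0 := neg_ne_zero.2 (inv_ne_zero h2)
  have cop1 := val_coprime _ u1
  have cop2 := val_coprime _ u2
  have z1 := ZMod.natCast_zmod_val (-c * r₁⁻¹)
  have z2 := ZMod.natCast_zmod_val (-(r₂')⁻¹)
  generalize (-c * r₁⁻¹).val = n1 at *
  generalize (-(r₂')⁻¹).val = n2 at *
  have hpp : 0 < p * p := Nat.mul_pos hp.out.pos hp.out.pos
  obtain ⟨v, k, hv⟩ := nt_inv (p * p) hpp n2 cop2
  obtain ⟨m1, l, hm⟩ := nt_inv (p * p) hpp (n2 * n1) (cop2.mul_left cop1)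
  have hmc : (m1 : ZMod p) = c := by
    have := congrArg (Int.cast : ℤ → ZMod p) hm
    push_cast at this
    rw [z1, z2] at this
    simp only [CharP.cast_eq_zero, zero_mul, add_zero] at this
    have e : (m1 : ZMod p) * c = r₁ * r₂' := by
      field_simp at this
      linear_combination this
    rw [h] at e
    exact mul_right_cancel₀ hc (by rw [e]; ring)
  let f : ℤ := (n2 - 1) * ((p * p : ℕ) * k)
  let d : ℤ := (1 - n2) * v
  let d1 : ℤ := 1 + d + (-(v : ℤ)) * (d + ((n2 : ℤ) - 1) * (1 + d))
  have hf : d + ((n2 : ℤ) - 1) * (1 + d) = f := by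
    simp only [d, f]; linear_combination ((n2 : ℤ) - 1) * hv * (-1)
  have he : 1 + (-(v : ℤ)) * (1 + ((n2 : ℤ) - 1)) = (p * p : ℕ) * k := by
    linear_combination -hv
  have hdet : d1 * n2 - ((p * p : ℕ) * k) * f = 1 := by
    rw [← he, ← hf]; simp only [d1]; ring
  let k0 : ℤ := v * (k * f + l) + k * (d1 - m1 * n1)
  have hd1 : (m1 * n1 : ℕ) + (p * p : ℕ) * k0 = d1 := by
    simp only [k0]
    push_cast at hv hm hdet ⊢
    linear_combination (d1 - m1 * n1) * hv - (v : ℤ) * hdet + (v : ℤ) * hm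
  obtain ⟨Φ, hΦ1, hΦ2⟩ := exists_homeo (-(v : ℤ)) ((n2 : ℤ) - 1) d
  let X : C(Sphere3 × Sphere3, Sphere3) := ContinuousMap.fst
  let Y : C(Sphere3 × Sphere3, Sphere3) := ContinuousMap.snd
  let F1 : C(Sphere3 × Sphere3, Sphere3) :=
    (Pw m1 n1).comp X * (((Pw p p).comp X) ^ k0 * ((Pw p p).comp Y) ^ k)
  let F2 : C(Sphere3 × Sphere3, Sphere3) :=
    (Pw 1 n2).comp Y * ((Pw p p).comp X) ^ ((n2 - 1) * k)
  refine dold ((actL 1 r₁).prod (actL 1 r₂')) ((actL c (-c)).prod (actL 1 (-1)))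
    (prod_free _ _ _ _ one_ne_zero h1 one_ne_zero h2)
    (prod_free _ _ _ _ hc (neg_ne_zero.2 hc) one_ne_zero (neg_ne_zero.2 one_ne_zero))
    πX πY hX hY hX' hY' (F1.prodMk F2) ?_ Φ ?_
  · rintro ⟨g, g'⟩ ⟨x, y⟩
    have inv1 : ∀ (a b : ZMod p) (w : Sphere3), Pw p p (rot a b w) = Pw p p w := by
      intro a b w
      rw [Pw_rot]
      simp [rot_zero]
    refine Prod.ext ?_ ?_
    · change Pw m1 n1 (rot (g * 1) (g * r₁) x) * ((Pw p p (rot (g * 1) (g * r₁) x)) ^ k0 *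
        (Pw p p (rot (g' * 1) (g' * r₂') y)) ^ k) =
        rot (g * c) (g * -c) (Pw m1 n1 x * ((Pw p p x) ^ k0 * (Pw p p y) ^ k))
      rw [inv1, inv1, Pw_rot]
      have a1 : (m1 : ZMod p) * (g * 1) = g * c := by rw [hmc]; ring
      have a2 : (n1 : ZMod p) * (g * r₁) = g * -c := by rw [z1]; field_simp
      rw [a1, a2, ← rot_mul]
      have a3 : g * c + g * -c = 0 := by ring
      rw [a3, rot_zero]
    · change Pw 1 n2 (rot (g' * 1) (g' * r₂') y) *
        (Pw p p (rot (g * 1) (g * r₁) x)) ^ ((n2 - 1) * k) =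
        rot (g' * 1) (g' * -1) (Pw 1 n2 y * (Pw p p x) ^ ((n2 - 1) * k))
      rw [inv1, Pw_rot]
      have a1 : ((1 : ℕ) : ZMod p) * (g' * 1) = g' * 1 := by simp
      have a2 : (n2 : ZMod p) * (g' * r₂') = g' * -1 := by rw [z2]; field_simp
      rw [a1, a2, ← rot_mul]
      have a3 : g' * 1 + g' * -1 = 0 := by ring
      rw [a3, rot_zero]
  · have H1 : (ContinuousMap.fst.comp (⟨Φ, Φ.continuous⟩ :
        C(Sphere3 × Sphere3, Sphere3 × Sphere3))).Homotopic F1 := by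
      rw [← cl_eq, hΦ1, he]
      simp only [F1]
      rw [cl_mul, cl_mul, cl_zpow, cl_zpow, cl_Pw, cl_Pw, cl_Pw]
      change cl X ^ d1 * cl Y ^ _ = _
      rw [← hd1, ← zpow_natCast, ← zpow_natCast, ← zpow_natCast, ← zpow_mul, ← zpow_mul,
        ← mul_assoc, ← zpow_add]
    have H2 : (ContinuousMap.snd.comp (⟨Φ, Φ.continuous⟩ :
        C(Sphere3 × Sphere3, Sphere3 × Sphere3))).Homotopic F2 := by
      rw [← cl_eq, hΦ2, hf]
      simp only [F2]
      rw [cl_mul, cl_zpow, cl_Pw, cl_Pw]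
      change cl Y ^ _ * cl X ^ _ = _
      rw [← zpow_natCast, ← zpow_natCast, ← zpow_mul]
      congr 2
      · push_cast; ring
      · simp only [f]; ring
    exact H1.prodMk H2

/-- squares up to sign -/
def Good (u : ZMod p) : Prop := ∃ s : ZMod p, u = s ^ 2 ∨ u = -s ^ 2

theorem prod_one (r₁ r₂ : ZMod p) (h1 : r₁ ≠ 0) (h2 : r₂ ≠ 0) (h : Good (r₁ * r₂)) :
    Nonempty (ContinuousMap.HomotopyEquiv (Lens p r₁ × Lens p r₂)
      (Lens p (1 : ZMod p) × Lens p (1 : ZMod p))) := by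
  obtain ⟨s, h | h⟩ := h
  · refine prod_main r₁ r₂ r₂ s h1 h2 ?_ (Or.inl rfl) h
    rintro rfl
    exact mul_ne_zero h1 h2 (by simpa using h)
  · refine prod_main r₁ r₂ (-r₂) s h1 (neg_ne_zero.2 h2) ?_ (Or.inr rfl) (by rw [mul_neg, h, neg_neg])
    rintro rfl
    exact mul_ne_zero h1 h2 (by simpa using h)

theorem single' (r q : ZMod p) (hr : r ≠ 0) (hq : q ≠ 0) (h : Good (r * q)) :
    Nonempty (ContinuousMap.HomotopyEquiv (Lens p r) (Lens p q)) := by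
  obtain ⟨s, h⟩ := h
  have hs : s ≠ 0 := by
    rintro rfl
    exact mul_ne_zero hr hq (by simpa using h)
  refine single r q (s * q⁻¹) hr hq (mul_ne_zero hs (inv_ne_zero hq)) ?_
  rcases h with h | h
  · left; field_simp; rw [← h, mul_comm]
  · right; field_simp; rw [mul_comm q r, h, neg_neg]

theorem good_mul {a b : ZMod p} (ha : Good a) (hb : Good b) : Good (a * b) := by
  obtain ⟨s, rfl | rfl⟩ := ha <;> obtain ⟨t, rfl | rfl⟩ := hb
  · exact ⟨s * t, Or.inl (by ring)⟩
  · exact ⟨s * t, Or.inr (by ring)⟩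
  · exact ⟨s * t, Or.inr (by ring)⟩
  · exact ⟨s * t, Or.inl (by ring)⟩

theorem good_cancel {a b : ZMod p} (hb0 : b ≠ 0) (hb : Good b) (h : Good (a * b)) : Good a := by
  have hb' : Good b⁻¹ := by
    obtain ⟨s, rfl | rfl⟩ := hb
    · exact ⟨s⁻¹, Or.inl (by simp)⟩
    · exact ⟨s⁻¹, Or.inr (by simp)⟩
  have := good_mul h hb'
  rwa [mul_inv_cancel_right₀ hb0] at this

theorem good_bad {a b : ZMod p} (ha : ¬ Good a) (hb : ¬ Good b) : Good (a * b) := by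
  have h1 : ¬ IsSquare a := fun ⟨s, hs⟩ => ha ⟨s, Or.inl (by rw [hs, sq])⟩
  have h2 : ¬ IsSquare b := fun ⟨s, hs⟩ => hb ⟨s, Or.inl (by rw [hs, sq])⟩
  have h3 : IsSquare (a * b) := by
    rw [← quadraticChar_neg_one_iff_not_isSquare] at h1 h2
    have h12 : quadraticChar (ZMod p) (a * b) = 1 := by rw [map_mul, h1, h2]; rfl
    have h0 : a * b ≠ 0 := by
      intro h0
      rw [h0] at h12
      simp at h12
    exact (quadraticChar_one_iff_isSquare h0).1 h12
  obtain ⟨s, hs⟩ := h3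
  exact ⟨s, Or.inl (by rw [hs, sq])⟩

theorem final (r₁ r₂ q₁ q₂ : ZMod p)
    (hr₁ : r₁ ≠ 0) (hr₂ : r₂ ≠ 0) (hq₁ : q₁ ≠ 0) (hq₂ : q₂ ≠ 0)
    (hz : ∃ z : ZMod p, r₁ * r₂ * z ^ 2 = q₁ * q₂ ∨ r₁ * r₂ * z ^ 2 = -(q₁ * q₂)) :
    Nonempty (ContinuousMap.HomotopyEquiv (Lens p r₁ × Lens p r₂) (Lens p q₁ × Lens p q₂)) := by
  have hr := mul_ne_zero hr₁ hr₂
  have hq := mul_ne_zero hq₁ hq₂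
  have hG : Good ((r₁ * r₂) * (q₁ * q₂)) := by
    obtain ⟨z, h | h⟩ := hz
    · exact ⟨r₁ * r₂ * z, Or.inl (by rw [← h]; ring)⟩
    · exact ⟨r₁ * r₂ * z, Or.inr (by rw [← neg_eq_iff_eq_neg.2 h]; ring)⟩
  by_cases g : Good (r₁ * r₂)
  · have g' : Good (q₁ * q₂) := good_cancel hr g (by rwa [mul_comm])
    obtain ⟨e⟩ := prod_one r₁ r₂ hr₁ hr₂ g
    obtain ⟨e'⟩ := prod_one q₁ q₂ hq₁ hq₂ g'
    exact ⟨e.trans e'.symm⟩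
  · by_cases g1 : Good (r₁ * q₁)
    · have g2 : Good (r₂ * q₂) := good_cancel (mul_ne_zero hr₁ hq₁) g1 (by convert hG using 1; ring)
      obtain ⟨e⟩ := single' r₁ q₁ hr₁ hq₁ g1
      obtain ⟨e'⟩ := single' r₂ q₂ hr₂ hq₂ g2
      exact ⟨e.prodCongr e'⟩
    · have g2 : Good (r₂ * q₁) := by
        refine good_cancel (pow_ne_zero 2 hr₁) ⟨r₁, Or.inl rfl⟩ ?_
        convert good_bad g g1 using 1; ring
      have g3 : Good (r₁ * q₂) := good_cancel (mul_ne_zero hr₂ hq₁) g2 (by convert hG using 1; ring)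
      obtain ⟨e⟩ := single' r₁ q₂ hr₁ hq₂ g3
      obtain ⟨e'⟩ := single' r₂ q₁ hr₂ hq₁ g2
      exact ⟨(e.prodCongr e').trans (Homeomorph.prodComm _ _).toHomotopyEquiv⟩

end LensProof

end parth

/-- For `p` an odd prime and units `r₁, r₂, q₁, q₂` of `ℤ/p`, if `±(r₁r₂)/(q₁q₂)` is a
quadratic residue mod `p`, then `L(p;r₁) × L(p;r₂)` is homotopy equivalent to
`L(p;q₁) × L(p;q₂)`. -/
theorem lens_space_products_homotopy_equivalent
    (p : ℕ) [Fact p.Prime] (hodd : Odd p)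
    (r₁ r₂ q₁ q₂ : ZMod p)
    (hr₁ : IsUnit r₁) (hr₂ : IsUnit r₂) (hq₁ : IsUnit q₁) (hq₂ : IsUnit q₂)
    (hz : ∃ z : ZMod p, r₁ * r₂ * z ^ 2 = q₁ * q₂ ∨ r₁ * r₂ * z ^ 2 = -(q₁ * q₂)) :
    Nonempty (ContinuousMap.HomotopyEquiv (Lens p r₁ × Lens p r₂) (Lens p q₁ × Lens p q₂)) := by
  exact LensProof.final r₁ r₂ q₁ q₂ hr₁.ne_zero hr₂.ne_zero hq₁.ne_zero hq₂.ne_zero hz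
end

section
/- Let p be an odd prime and let k ≥ 1 be an integer. The group cohomology of G = ℤ/p × ℤ/p in degree 2k with coefficients in ℤ regarded as a trivial G-module is isomorphic, as an abelian group, to (ℤ/p)^{k+1}. -/
namespace ZpZp
open CategoryTheory

section basic
variable {p : ℕ} [Fact p.Prime] {k : Type} [CommRing k] {M M' : Type} [AddCommGroup M] [AddCommGroup M'] [Module k M] [Module k M']

/-- difference operator for even `i` norm -/
noncomputable def A (p : ℕ) [Fact p.Prime] (k : Type) [CommRing k] (M : Type) [AddCommGroup M] [Module k M] (i : ℕ) :
    (ZMod p → M) →ₗ[k] (ZMod p → M) where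
  toFun f x := if Even i then ∑ y, f y else f (x - 1) - f x
  map_add' f g := by
    ext x; dsimp; split_ifs
    · simp [Finset.sum_add_distrib]
    · abel
  map_smul' c f := by
    ext x; dsimp; split_ifs
    · simp [Finset.smul_sum]
    · simp [smul_sub]

lemma A_apply (i : ℕ) (f : ZMod p → M) (x : ZMod p) :
    A p k M i f x = if Even i then ∑ y, f y else f (x - 1) - f x := rfl

lemma A_nat (h : M →ₗ[k] M') (i : ℕ) (f : ZMod p → M) (x : ZMod p) :
    A p k M' i (fun y => h (f y)) x = h (A p k M i f x) := by
  simp only [A_apply]; split_ifs <;> simp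

lemma A_trans (a : ZMod p) (i : ℕ) (f : ZMod p → M) (x : ZMod p) :
    A p k M i (fun y => f (y - a)) x = A p k M i f (x - a) := by
  simp only [A_apply]; split_ifs
  · exact Fintype.sum_equiv (Equiv.subRight a) _ _ (fun _ => rfl)
  · congr 2; ring

lemma A_A (i : ℕ) (f : ZMod p → M) : A p k M i (A p k M (i + 1) f) = 0 := by
  ext x
  simp only [A_apply, Nat.even_add_one]
  by_cases h : Even i
  · simp only [h, if_true, not_true, if_false, Finset.sum_sub_distrib, Pi.zero_apply, sub_eq_zero]
    exact Fintype.sum_equiv (Equiv.subRight 1) _ _ (fun _ => rfl)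
  · simp [h]

variable (k) in
lemma exists_D (f : ZMod p → M) (hf : ∑ y, f y = 0) : ∃ g, A p k M 1 g = f := by
  obtain ⟨q, rfl⟩ : ∃ q, p = q + 1 := ⟨p - 1, by have := (Fact.out : p.Prime).pos; omega⟩
  let s : ℕ → M := fun n => ∑ j ∈ Finset.range (n + 1), f (j : ZMod (q+1))
  have htot : s q = 0 := by
    rw [← hf]
    change ∑ j ∈ Finset.range (q + 1), f (j : ZMod (q+1)) = ∑ y : Fin (q + 1), f y
    rw [Finset.sum_range]
    refine Finset.sum_congr rfl fun i _ => ?_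
    congr 1
    exact Fin.cast_val_eq_self i
  refine ⟨fun x => - s x.val, ?_⟩
  ext x
  simp only [A_apply, Nat.not_even_one, if_false]
  by_cases hx : x = 0
  · subst hx
    have h1 : ((0 : ZMod (q+1)) - 1).val = q := by
      simp [ZMod.val_neg_one]
    rw [h1, htot]; simp [s]
  · obtain ⟨m, hm⟩ : ∃ m, x.val = m + 1 :=
      ⟨x.val - 1, by have := (ZMod.val_ne_zero x).2 hx; omega⟩
    have hlt := ZMod.val_lt x
    have hxm : x = ((m + 1 : ℕ) : ZMod (q+1)) := by rw [← hm, ZMod.natCast_zmod_val]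
    have h1 : (x - 1).val = m := by
      rw [hxm]; push_cast; rw [add_sub_cancel_right, ZMod.val_natCast_of_lt (by omega)]
    rw [h1, hm]
    simp only [s]
    rw [Finset.sum_range_succ _ (m + 1), ← hxm]
    abel

variable (k) in
lemma A_one_iff (f : ZMod p → M) : (∃ g, A p k M 1 g = f) ↔ ∑ y, f y = 0 := by
  refine ⟨?_, exists_D k f⟩
  rintro ⟨g, rfl⟩
  simpa [A_apply] using congrFun (A_A (k := k) 0 g) 0

lemma A_odd {i : ℕ} (hi : ¬ Even i) : A p k M i = A p k M 1 := by
  ext f x; simp [A_apply, hi]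

lemma exists_A (i : ℕ) (hi : 1 ≤ i) (f : ZMod p → M) (hf : A p k M i f = 0) :
    ∃ g, A p k M (i + 1) g = f := by
  by_cases h : Even i
  · rw [A_odd (by simpa [Nat.even_add_one] using h), A_one_iff k]
    simpa [A_apply, h] using congrFun hf 0
  · refine ⟨Pi.single 0 (f 0), ?_⟩
    have h1 : ∀ x, f (x - 1) = f x := fun x => by
      simpa [A_apply, h, sub_eq_zero] using congrFun hf x
    have h2 : ∀ n : ℕ, f n = f 0 := fun n => by
      induction n with
      | zero => simp
      | succ n ih => rw [← ih, ← h1]; simp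
    ext x
    have := h2 x.val
    rw [ZMod.natCast_zmod_val] at this
    simp [A_apply, Nat.even_add_one, h, this]

end basic

section dbl
variable (p : ℕ) [Fact p.Prime] (k : Type) [CommRing k]

abbrev R (p : ℕ) (k : Type) := ZMod p → ZMod p → k

/-- horizontal -/
noncomputable abbrev Al (i : ℕ) : R p k →ₗ[k] R p k := A p k (ZMod p → k) i
/-- vertical -/
noncomputable abbrev Be (i : ℕ) : R p k →ₗ[k] R p k := (A p k k i).compLeft (ZMod p)

variable {p} {k}
lemma Be_apply (i : ℕ) (f : R p k) (x) : Be p k i f x = A p k k i (f x) := rfl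

lemma Al_Be (i j : ℕ) (f : R p k) : Al p k i (Be p k j f) = Be p k j (Al p k i f) := by
  ext x : 1
  exact A_nat (A p k k j) i f x

lemma Be_Be (i : ℕ) (f : R p k) : Be p k i (Be p k (i + 1) f) = 0 := by
  ext x : 1
  exact A_A (k := k) i (f x)

lemma exists_Be_aux (i : ℕ) (f : R p k) (h : ∃ h, A p k k (i + 1) h = ∑ x, f x) :
    ∃ g0 g1, Al p k 1 g1 + Be p k (i + 1) g0 = f := by
  obtain ⟨h, hh⟩ := h
  refine ⟨Pi.single 0 h, ?_⟩
  have := (A_one_iff k (f - Be p k (i + 1) (Pi.single 0 h))).2 (by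
    have h2 : Be p k (i + 1) (Pi.single 0 h) = Pi.single 0 (A p k k (i + 1) h) := by
      ext x : 1
      rw [Be_apply]
      by_cases hx : x = 0
      · subst hx; simp
      · simp [hx]
    rw [h2]
    simp [hh, Finset.sum_sub_distrib])
  obtain ⟨g, hg⟩ := this
  exact ⟨g, by rw [Al, hg]; simp⟩

lemma exists_Be (i : ℕ) (hi : 1 ≤ i) (f g : R p k) (h : Al p k 1 g + Be p k i f = 0) :
    ∃ g0 g1, Al p k 1 g1 + Be p k (i + 1) g0 = f := by
  apply exists_Be_aux
  apply exists_A i hi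
  have h1 : ∃ g, A p k (ZMod p → k) 1 g = Be p k i f := ⟨-g, by rw [map_neg]; exact neg_eq_of_add_eq_zero_right h⟩
  rw [A_one_iff k] at h1
  rw [map_sum]; exact h1

lemma exists_Be_zero (f : R p k) (h : ∑ x, ∑ y, f x y = 0) :
    ∃ g0 g1, Al p k 1 g1 + Be p k 1 g0 = f := by
  apply exists_Be_aux 0
  rw [zero_add, A_one_iff k]
  rw [Finset.sum_comm] at h
  simpa using h

/-- differential -/
noncomputable def dd (p : ℕ) [Fact p.Prime] (k : Type) [CommRing k] (n : ℕ) :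
    (Fin (n + 2) → R p k) →ₗ[k] (Fin (n + 1) → R p k) where
  toFun f i := Al p k (i + 1) (f i.succ) + (-1 : k) ^ (i : ℕ) • Be p k (n - i + 1) (f i.castSucc)
  map_add' f g := by ext i : 1; simp; abel
  map_smul' c f := by ext i : 1; simp only [Pi.smul_apply, map_smul, smul_add, smul_comm c, RingHom.id_apply]

lemma dd_apply (n : ℕ) (f : Fin (n + 2) → R p k) (i) :
    dd p k n f i = Al p k (i + 1) (f i.succ) +
      (-1 : k) ^ (i : ℕ) • Be p k (n - i + 1) (f i.castSucc) := rfl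

lemma dd_dd (n : ℕ) (f : Fin (n + 3) → R p k) : dd p k n (dd p k (n + 1) f) = 0 := by
  ext i : 1
  have hi := i.2
  have e1 : n + 1 - ((i : ℕ) + 1) + 1 = n - i + 1 := by omega
  have e2 : n + 1 - (i : ℕ) + 1 = (n - i + 1) + 1 := by omega
  simp only [dd_apply, map_add, map_smul, Fin.val_succ, Fin.val_castSucc, e1, e2, Be_Be,
    Al_Be, Fin.succ_castSucc]
  rw [show Al p k (i + 1) (Al p k (i + 1 + 1) (f i.succ.succ)) = 0 from A_A _ _]
  simp [pow_succ]

lemma dd_exact (n : ℕ) (f : Fin (n + 2) → R p k) (hf : dd p k n f = 0) :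
    ∃ g, dd p k (n + 1) g = f := by
  have hf' : ∀ i (hi : i < n + 1), Al p k (i + 1) (f ⟨i + 1, by omega⟩) +
      (-1 : k) ^ i • Be p k (n - i + 1) (f ⟨i, by omega⟩) = 0 := fun i hi => congrFun hf ⟨i, hi⟩
  have key : ∀ m, m ≤ n + 1 → ∃ g : ℕ → R p k, ∀ i (hi : i ≤ m) (hm : i < n + 2), Al p k (i + 1) (g (i + 1)) +
      (-1 : k) ^ i • Be p k (n + 1 - i + 1) (g i) = f ⟨i, hm⟩ := by
    intro m
    induction m with
    | zero =>
      intro _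
      have := hf' 0 (by omega)
      simp only [pow_zero, one_smul, Nat.sub_zero] at this
      obtain ⟨g0, g1, h⟩ := exists_Be (n + 1) (by omega) _ _ this
      refine ⟨fun i => if i = 0 then g0 else g1, ?_⟩
      intro i hi hm
      obtain rfl : i = 0 := by omega
      simpa using h
    | succ m ih =>
      intro hm
      obtain ⟨g, hg⟩ := ih (by omega)
      have h1 := hg m le_rfl (by omega)
      have h2 := hf' m (by omega)
      rw [← h1] at h2
      have e1 : n + 1 - (m : ℕ) + 1 = (n - m + 1) + 1 := by omega
      have e2 : n + 1 - ((m : ℕ) + 1) + 1 = n - m + 1 := by omega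
      rw [map_add, map_smul, e1, Be_Be, smul_zero, add_zero, ← Al_Be, ← map_smul, ← map_add] at h2
      obtain ⟨x, hx⟩ := exists_A (m + 1) (by omega) _ h2
      refine ⟨fun i => if i = m + 2 then x else g i, ?_⟩
      intro i hi hm
      rcases Nat.lt_or_ge m i with h | h
      · obtain rfl : i = m + 1 := by omega
        simp only [e2]
        simp [hx, Al, pow_succ]
      · have := hg i h (by omega)
        rw [← this]
        have h3 : ¬ i = m + 2 := by omega
        have h4 : ¬ i + 1 = m + 2 := by omega
        simp only [h3, h4, if_false]
  obtain ⟨g, hg⟩ := key (n + 1) le_rfl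
  refine ⟨fun i => g i, ?_⟩
  ext i : 1
  rw [dd_apply]
  exact hg i (by omega) i.2

lemma dd_exact0 (f : Fin 1 → R p k) (hf : ∑ x, ∑ y, f 0 x y = 0) :
    ∃ g, dd p k 0 g = f := by
  obtain ⟨g0, g1, h⟩ := exists_Be_zero _ hf
  refine ⟨![g0, g1], ?_⟩
  ext i : 1
  obtain rfl : i = 0 := by omega
  simpa [dd_apply] using h

lemma dd_sum (g) : ∑ x, ∑ y, dd p k 0 g 0 x y = 0 := by
  have h1 : ∑ x, Al p k 1 (g 1) x = 0 := (A_one_iff k _).1 ⟨_, rfl⟩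
  have h2 : ∀ x, ∑ y, Be p k 1 (g 0) x y = 0 := fun x => (A_one_iff k _).1 ⟨_, rfl⟩
  have h3 : ∑ x, ∑ y, Al p k 1 (g 1) x y = 0 := by
    rw [Finset.sum_comm]
    have := congrArg (fun v => ∑ y, v y) h1
    simpa using this
  have : ∀ x y, dd p k 0 g 0 x y = Al p k 1 (g 1) x y + Be p k 1 (g 0) x y := by
    intro x y; simp [dd_apply]
  simp_rw [this, Finset.sum_add_distrib, h2, h3]; simp

end dbl
end ZpZp
namespace ZpZp
open CategoryTheory

section rep
variable (p : ℕ) [Fact p.Prime] (k : Type) [CommRing k]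

abbrev G (p : ℕ) := Multiplicative (ZMod p × ZMod p)

/-- translation -/
noncomputable def tr (n : ℕ) : Representation k (G p) (Fin (n + 1) → R p k) where
  toFun g :=
    { toFun f i x y := f i (x - g.toAdd.1) (y - g.toAdd.2)
      map_add' _ _ := rfl
      map_smul' _ _ := rfl }
  map_one' := by ext f i x y; simp
  map_mul' g h := by ext f i x y; simp [sub_sub]

variable {p} {k}
lemma tr_apply (n : ℕ) (g : G p) (f : Fin (n + 1) → R p k) (i x y) :
  tr p k n g f i x y = f i (x - g.toAdd.1) (y - g.toAdd.2) := rfl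

variable (p k) in
noncomputable abbrev P (n : ℕ) : Rep.{0} k (G p) := Rep.of (tr p k n)

/-- basis vector -/
noncomputable def e (n : ℕ) (i : Fin (n + 1)) : Fin (n + 1) → R p k :=
  Pi.single i (Pi.single 0 (Pi.single 0 1))

noncomputable def lift (n : ℕ) (B : Rep.{0} k (G p)) (v : Fin (n + 1) → B) : P p k n ⟶ B :=
  Rep.ofHom
    { toFun := fun f => ∑ i, ∑ x, ∑ y, f i x y • B.ρ (Multiplicative.ofAdd (x, y)) (v i)
      map_add' := fun f g => by simp [add_smul, Finset.sum_add_distrib]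
      map_smul' := fun c f => by simp [mul_smul, Finset.smul_sum]
      isIntertwining' := fun g => by
        refine LinearMap.ext fun f => ?_
        change ∑ i, ∑ x, ∑ y, tr p k n g f i x y • B.ρ (Multiplicative.ofAdd (x, y)) (v i) =
          B.ρ g (∑ i, ∑ x, ∑ y, f i x y • B.ρ (Multiplicative.ofAdd (x, y)) (v i))
        simp only [map_sum, tr_apply, map_smul]
        refine Finset.sum_congr rfl fun i _ => ?_
        refine Fintype.sum_equiv (Equiv.subRight g.toAdd.1) _ _ fun x => ?_
        refine Fintype.sum_equiv (Equiv.subRight g.toAdd.2) _ _ fun y => ?_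
        simp only [Equiv.subRight_apply, ← Module.End.mul_apply, ← map_mul]
        congr 3
        apply Multiplicative.toAdd.injective
        ext <;> simp }

lemma lift_apply (n : ℕ) (B : Rep.{0} k (G p)) (v : Fin (n + 1) → B) (f : Fin (n + 1) → R p k) :
    (lift n B v).hom f = ∑ i, ∑ x, ∑ y, f i x y • B.ρ (Multiplicative.ofAdd (x, y)) (v i) := rfl

lemma lift_e (n : ℕ) (B : Rep.{0} k (G p)) (v : Fin (n + 1) → B) (i) :
    (lift n B v).hom (e n i) = v i := by
  rw [lift_apply]
  rw [Finset.sum_eq_single i, Finset.sum_eq_single 0, Finset.sum_eq_single 0]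
  · simp [e]
    rw [show (Multiplicative.ofAdd ((0 : ZMod p), (0 : ZMod p))) = 1 from rfl]
    simp
  all_goals simp +contextual [e]

lemma decomp (n : ℕ) (f : Fin (n + 1) → R p k) :
    f = ∑ i, ∑ x, ∑ y, f i x y • tr p k n (Multiplicative.ofAdd (x, y)) (e n i) := by
  ext i x y
  simp only [Finset.sum_apply, Pi.smul_apply, tr_apply, e]
  rw [Finset.sum_eq_single i, Finset.sum_eq_single x, Finset.sum_eq_single y]
  · simp
  · intro b _ hb; simp [sub_eq_zero, hb.symm]
  · simp
  · intro b _ hb; simp [sub_eq_zero, hb.symm]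
  · simp
  · intro b _ hb; simp [hb.symm]
  · simp

lemma hom_eq_lift (n : ℕ) (B : Rep.{0} k (G p)) (φ : P p k n ⟶ B) :
    φ = lift n B (fun i => φ.hom (e n i)) := by
  apply Rep.hom_ext
  refine DFunLike.ext _ _ fun f => ?_
  rw [lift_apply]
  conv_lhs => rw [decomp n f]
  simp only [map_sum, map_smul]
  refine Finset.sum_congr rfl fun i _ => Finset.sum_congr rfl fun x _ =>
    Finset.sum_congr rfl fun y _ => ?_
  congr 1
  exact Rep.hom_comm_apply φ _ _

lemma P_ext (n : ℕ) {B : Rep.{0} k (G p)} (φ ψ : P p k n ⟶ B)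
    (h : ∀ i, φ.hom (e n i) = ψ.hom (e n i)) : φ = ψ := by
  rw [hom_eq_lift n B φ, hom_eq_lift n B ψ]
  congr 1
  exact funext h

instance P_proj (n : ℕ) : Projective (P p k n) where
  factors {E X} f q hq := by
    rw [Rep.epi_iff_surjective] at hq
    choose s hs using hq
    refine ⟨lift n E (fun i => s (f.hom (e n i))), P_ext n _ _ fun i => ?_⟩
    rw [Rep.hom_comp, Representation.IntertwiningMap.comp_apply, lift_e]
    exact hs _

variable (p k) in
noncomputable def dR (n : ℕ) : P p k (n + 1) ⟶ P p k n :=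
  Rep.ofHom
    { dd p k n with
      isIntertwining' := fun g => by
        refine LinearMap.ext fun f => ?_
        ext i x y
        change dd p k n (tr p k (n + 1) g f) i x y = tr p k n g (dd p k n f) i x y
        rw [tr_apply, dd_apply, dd_apply]
        simp only [Pi.add_apply, Pi.smul_apply, Be_apply]
        congr 1
        · let L : (ZMod p → k) →ₗ[k] (ZMod p → k) :=
            { toFun := fun v y => v (y - g.toAdd.2)
              map_add' := fun _ _ => rfl
              map_smul' := fun _ _ => rfl }
          have h1 := A_nat L (i + 1) (fun x => f i.succ (x - g.toAdd.1)) x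
          have h2 := congrFun h1 y
          refine h2.trans ?_
          rw [A_trans]; rfl
        · congr 1
          exact A_trans g.toAdd.2 _ (f i.castSucc (x - g.toAdd.1)) y }

lemma dR_apply (n : ℕ) (f : Fin (n + 2) → R p k) : (dR p k n).hom f = dd p k n f := rfl

variable (p k) in
noncomputable abbrev cplx : ChainComplex (Rep.{0} k (G p)) ℕ :=
  ChainComplex.of (fun n => P p k n) (fun n => dR p k n) fun n => by
    apply Rep.hom_ext
    refine DFunLike.ext _ _ fun f => ?_
    exact dd_dd n f

lemma cplx_d (n : ℕ) : (cplx p k).d (n + 1) n = dR p k n := ChainComplex.of_d _ _ _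

variable (p k) in
noncomputable def eps : P p k 0 ⟶ Rep.trivial k (G p) k := lift 0 _ (fun _ => (1 : k))

lemma eps_apply (f : Fin 1 → R p k) : (eps p k).hom f = ∑ x, ∑ y, f 0 x y := by
  rw [eps, lift_apply]; simp

variable (p k) in
noncomputable def piR : cplx p k ⟶ (ChainComplex.single₀ (Rep.{0} k (G p))).obj (Rep.trivial k (G p) k) :=
  ((cplx p k).toSingle₀Equiv _).symm ⟨eps p k, by
    rw [cplx_d]
    apply Rep.hom_ext
    refine DFunLike.ext _ _ fun f => ?_
    rw [Rep.hom_comp, Representation.IntertwiningMap.comp_apply]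
    refine (eps_apply _).trans ?_
    exact dd_sum f⟩

lemma piR_f : (piR p k).f 0 = eps p k := by
  simp [piR, ChainComplex.toSingle₀Equiv]

lemma eps_surj (x : k) : ∃ f : Fin 1 → R p k, (eps p k).hom f = x := by
  refine ⟨fun _ => Pi.single 0 (Pi.single 0 x), ?_⟩
  refine (eps_apply _).trans ?_
  rw [Finset.sum_eq_single 0]
  · simp
  · intro b _ hb; simp [hb]
  · simp

lemma qi : QuasiIso (piR p k) where
  quasiIsoAt m := by
    cases m with
    | zero =>
      rw [ChainComplex.quasiIsoAt₀_iff, ShortComplex.quasiIso_iff_of_zeros' _ rfl rfl rfl]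
      constructor
      · apply (forget₂ _ (ModuleCat k)).reflects_exact_of_faithful
        rw [ShortComplex.moduleCat_exact_iff]
        intro f hf
        have h1 : (eps p k).hom f = 0 := by
          refine Eq.trans ?_ hf
          rw [← piR_f]; rfl
        obtain ⟨g, hg⟩ := dd_exact0 f ((eps_apply _).symm.trans h1)
        refine ⟨g, Eq.trans ?_ hg⟩
        change ((cplx p k).d 1 0).hom g = _
        rw [cplx_d]; rfl
      · rw [Rep.epi_iff_surjective]
        intro x
        obtain ⟨f, hf⟩ := eps_surj (p := p) (k := k) x
        refine ⟨f, Eq.trans ?_ hf⟩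
        rw [← piR_f]; rfl
    | succ m =>
      rw [quasiIsoAt_iff_exactAt' (hL := ChainComplex.exactAt_succ_single_obj ..),
          HomologicalComplex.exactAt_iff' _ (m + 2) (m + 1) m (by simp) (by simp)]
      apply (forget₂ _ (ModuleCat k)).reflects_exact_of_faithful
      rw [ShortComplex.moduleCat_exact_iff]
      intro f hf
      have h1 : (dR p k m).hom f = 0 := by
        refine Eq.trans ?_ hf
        rw [← cplx_d]; rfl
      obtain ⟨g, hg⟩ := dd_exact m f h1
      refine ⟨g, Eq.trans ?_ hg⟩
      change ((cplx p k).d (m + 2) (m + 1)).hom g = _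
      rw [cplx_d]; rfl

variable (p k) in
noncomputable def res : ProjectiveResolution (Rep.trivial k (G p) k) where
  complex := cplx p k
  projective n := P_proj n
  π := piR p k
  quasiIso := qi

end rep
end ZpZp
namespace ZpZp
open CategoryTheory

section coh
variable {p : ℕ} [Fact p.Prime] {k : Type} [CommRing k]

lemma nonempty_homology (S : ShortComplex (ModuleCat.{0} k)) {T : Type} [AddCommGroup T] [Module k T]
    (ψ : S.X₂ →ₗ[k] T) (hs : ∀ t, ∃ x, S.g.hom x = 0 ∧ ψ x = t)
    (hk : ∀ x, S.g.hom x = 0 → (ψ x = 0 ↔ ∃ y, S.f.hom y = x)) :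
    Nonempty (S.homology ≃+ T) := by
  let ψ' : LinearMap.ker S.g.hom →ₗ[k] T := ψ ∘ₗ (LinearMap.ker S.g.hom).subtype
  have hs' : Function.Surjective ψ' := fun t => by
    obtain ⟨x, h1, h2⟩ := hs t
    exact ⟨⟨x, h1⟩, h2⟩
  have hk' : LinearMap.range S.moduleCatToCycles = LinearMap.ker ψ' := by
    ext ⟨x, hx⟩
    rw [LinearMap.mem_ker, LinearMap.mem_range]
    refine Iff.trans ?_ (hk x hx).symm
    constructor
    · rintro ⟨y, hy⟩; exact ⟨y, congrArg Subtype.val hy⟩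
    · rintro ⟨y, hy⟩; exact ⟨y, Subtype.ext hy⟩
  exact ⟨(S.moduleCatHomologyIso.toLinearEquiv.toAddEquiv).trans
    ((Submodule.quotEquivOfEq _ _ hk').trans (ψ'.quotKerEquivOfSurjective hs')).toAddEquiv⟩

/-- total sum -/
def tot (f : R p k) : k := ∑ x, ∑ y, f x y

/-- augmentation of the operators -/
def av (p : ℕ) (k : Type) [CommRing k] (j : ℕ) : k := if Even j then (p : k) else 0

lemma sum_A (j : ℕ) (M : Type) [AddCommGroup M] [Module k M] (f : ZMod p → M) :
    ∑ x, A p k M j f x = av p k j • ∑ x, f x := by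
  unfold av
  split_ifs with h
  · simp [A_apply, h, ZMod.card, Nat.cast_smul_eq_nsmul]
  · rw [zero_smul, A_odd h]
    exact (A_one_iff k _).1 ⟨_, rfl⟩

lemma tot_Al (j : ℕ) (f : R p k) : tot (Al p k j f) = av p k j * tot f := by
  unfold tot
  rw [Finset.sum_comm]
  have := congrArg (fun v => ∑ y, v y) (sum_A (k := k) j _ f)
  simp only [Finset.sum_apply, Pi.smul_apply, smul_eq_mul] at this
  rw [this, ← Finset.mul_sum, Finset.sum_comm]

lemma tot_Be (j : ℕ) (f : R p k) : tot (Be p k j f) = av p k j * tot f := by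
  unfold tot
  simp only [Be_apply, sum_A]
  simp [Finset.mul_sum]

lemma tot_add (f g : R p k) : tot (f + g) = tot f + tot g := by
  simp [tot, Finset.sum_add_distrib]

lemma tot_smul (c : k) (f : R p k) : tot (c • f) = c * tot f := by
  simp [tot, Finset.mul_sum]

lemma tot_e (n : ℕ) (i l : Fin (n + 1)) : tot (e (p := p) (k := k) n i l) = if l = i then 1 else 0 := by
  unfold tot e
  by_cases h : l = i
  · subst h
    simp only [Pi.single_eq_same, if_true]
    rw [Finset.sum_eq_single 0]
    · simp
    · intro b _ hb; simp [hb]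
    · simp
  · simp [h]

abbrev T (p : ℕ) (k : Type) [CommRing k] : Rep.{0} k (G p) := Rep.trivial k (G p) k

lemma hom_triv (n : ℕ) (φ : P p k n ⟶ T p k) (f : Fin (n + 1) → R p k) :
    φ.hom f = ∑ l, tot (f l) * φ.hom (e n l) := by
  conv_lhs => rw [hom_eq_lift n _ φ]
  rw [lift_apply]
  simp [tot, Finset.sum_mul]

lemma d_hom (n : ℕ) (φ : P p k n ⟶ T p k) (i : Fin (n + 2)) :
    (dR p k n ≫ φ).hom (e (n + 1) i) =
      ∑ l : Fin (n + 1), ((if l.succ = i then av p k (l + 1) else 0) +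
        (if l.castSucc = i then (-1) ^ (l : ℕ) * av p k (n - l + 1) else 0)) * φ.hom (e n l) := by
  rw [Rep.hom_comp, Representation.IntertwiningMap.comp_apply, dR_apply]
  refine (hom_triv n φ _).trans ?_
  refine Finset.sum_congr rfl fun l _ => ?_
  rw [dd_apply, tot_add, tot_smul, tot_Al, tot_Be, tot_e, tot_e]
  simp

lemma d_hom_zero (n : ℕ) (φ : P p k n ⟶ T p k) :
    (dR p k n ≫ φ).hom (e (n + 1) 0) = av p k (n + 1) * φ.hom (e n 0) := by
  rw [d_hom, Finset.sum_eq_single 0]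
  · simp
  · intro b _ hb
    simp [Fin.succ_ne_zero, hb]
  · simp

lemma d_hom_succ (n : ℕ) (φ : P p k n ⟶ T p k) (l : ℕ) (hl : l < n) :
    (dR p k n ≫ φ).hom (e (n + 1) ⟨l + 1, by omega⟩) =
      av p k (l + 1) * φ.hom (e n ⟨l, by omega⟩) +
      (-1) ^ (l + 1) * av p k (n - l) * φ.hom (e n ⟨l + 1, by omega⟩) := by
  rw [d_hom]
  simp only [add_mul, Finset.sum_add_distrib]
  congr 1
  · rw [Finset.sum_eq_single ⟨l, by omega⟩]
    · simp
    · intro b _ hb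
      rw [if_neg, zero_mul]
      intro h; apply hb; ext; simpa [Fin.ext_iff] using h
    · simp
  · rw [Finset.sum_eq_single ⟨l + 1, by omega⟩]
    · simp [show n - (l + 1) + 1 = n - l by omega]
    · intro b _ hb
      rw [if_neg, zero_mul]
      intro h; apply hb; ext; simpa [Fin.ext_iff] using h
    · simp

lemma d_hom_last (n : ℕ) (φ : P p k n ⟶ T p k) :
    (dR p k n ≫ φ).hom (e (n + 1) ⟨n + 1, by omega⟩) =
      av p k (n + 1) * φ.hom (e n ⟨n, by omega⟩) := by
  rw [d_hom, Finset.sum_eq_single ⟨n, by omega⟩]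
  · simp [Fin.ext_iff]
  · intro b _ hb
    have : (b : ℕ) ≠ n := fun h => hb (Fin.ext h)
    have h2 : ¬ (b : ℕ) = n + 1 := by omega
    simp [Fin.ext_iff, this, h2]
  · simp

lemma av_even {j : ℕ} (h : Even j) : av p k j = p := by simp [av, h]
lemma av_odd {j : ℕ} (h : ¬ Even j) : av p k j = 0 := by simp [av, h]

/-- cocycles in even degree -/
lemma cocycle_iff (m : ℕ) (φ : P p ℤ (2 * m) ⟶ T p ℤ) :
    dR p ℤ (2 * m) ≫ φ = 0 ↔
      ∀ i : Fin (2 * m + 1), ¬ Even (i : ℕ) → φ.hom (e (2 * m) i) = (0 : ℤ) := by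
  have hp : (p : ℤ) ≠ 0 := by exact_mod_cast (Fact.out : p.Prime).ne_zero
  constructor
  · rintro h ⟨l, hl⟩ hodd
    have hodd' : ¬ Even l := hodd
    have hlt : l < 2 * m := by
      rcases Nat.lt_or_ge l (2 * m) with h | h
      · exact h
      · exact absurd (by rw [show l = 2 * m by omega]; simp) hodd'
    have h1 := d_hom_succ (2 * m) φ l hlt
    rw [h, av_even (by simpa [Nat.even_add_one] using hodd'),
      av_odd (by rw [Nat.even_sub hlt.le]; simpa using hodd')] at h1
    have h2 : (0 : ℤ) = p * φ.hom (e (2 * m) ⟨l, hl⟩) := by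
      simpa using h1
    exact (mul_eq_zero.1 h2.symm).resolve_left hp
  · intro h
    refine P_ext _ _ _ fun i => ?_
    change _ = (0 : ℤ)
    obtain ⟨i, hi⟩ := i
    rcases i with _ | l
    · refine (d_hom_zero _ _).trans ?_
      rw [av_odd (by simp)]; exact zero_mul _
    · rcases Nat.lt_or_ge l (2 * m) with hl | hl
      · refine (d_hom_succ _ _ l hl).trans ?_
        by_cases hev : Even l
        · rw [av_odd (by simpa [Nat.even_add_one] using hev),
            h ⟨l + 1, by omega⟩ (by simpa [Nat.even_add_one] using hev)]
          simp
        · rw [h ⟨l, by omega⟩ hev, av_odd (j := 2 * m - l) (by rw [Nat.even_sub hl.le]; simpa using hev)]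
          simp
      · obtain rfl : l = 2 * m := by omega
        refine (d_hom_last _ _).trans ?_
        rw [av_odd (by simp)]; exact zero_mul _

lemma coboundary_iff (n m : ℕ) (hn : n + 1 = 2 * m) (φ : P p ℤ (n + 1) ⟶ T p ℤ) :
    (∃ b : P p ℤ n ⟶ T p ℤ, dR p ℤ n ≫ b = φ) ↔
      ∀ i : Fin (n + 2), if Even (i : ℕ) then (p : ℤ) ∣ φ.hom (e (n + 1) i)
        else φ.hom (e (n + 1) i) = (0 : ℤ) := by
  have hne : Even (n + 1) := by rw [hn]; simp
  constructor
  · rintro ⟨b, rfl⟩ ⟨i, hi⟩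
    rcases i with _ | l
    · simp only [Even.zero, if_true]
      have := d_hom_zero n b
      rw [av_even hne] at this
      exact ⟨_, this⟩
    · rcases Nat.lt_or_ge l n with hl | hl
      · have := d_hom_succ n b l hl
        by_cases hev : Even l
        · rw [if_neg (by simpa [Nat.even_add_one] using hev), this,
            av_odd (by simpa [Nat.even_add_one] using hev), av_odd (by
              rw [Nat.even_sub hl.le]; rw [Nat.even_add_one] at hne; tauto)]
          simp
        · rw [if_pos (by simpa [Nat.even_add_one] using hev), this,
            av_even (by simpa [Nat.even_add_one] using hev), av_even (j := n - l) (by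
              rw [Nat.even_sub hl.le]; rw [Nat.even_add_one] at hne; tauto)]
          exact dvd_add (Dvd.intro _ rfl) ⟨(-1) ^ (l + 1) * b.hom (e n ⟨l + 1, by omega⟩), by ring⟩
      · obtain rfl : l = n := by omega
        have := d_hom_last l b
        rw [if_pos hne, this, av_even hne]
        exact Dvd.intro _ rfl
  · intro h
    have h1 : ∀ i : Fin (n + 2), ∃ q : ℤ, Even (i : ℕ) → φ.hom (e (n + 1) i) = p * q := by
      intro i
      by_cases hi : Even (i : ℕ)
      · have := h i
        rw [if_pos hi] at this
        obtain ⟨q, hq⟩ := this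
        exact ⟨q, fun _ => hq⟩
      · exact ⟨0, fun h => absurd h hi⟩
    choose q hq using h1
    let b : P p ℤ n ⟶ T p ℤ := lift n _ (fun l => if (l : ℕ) = 0 then q 0 else
      if Even (l : ℕ) then (0 : ℤ) else q l.succ)
    have hb : ∀ l : Fin (n + 1), b.hom (e n l) = if (l : ℕ) = 0 then q 0 else
      if Even (l : ℕ) then (0 : ℤ) else q l.succ := fun l => lift_e n _ _ l
    refine ⟨b, P_ext _ _ _ fun i => ?_⟩
    obtain ⟨i, hi⟩ := i
    rcases i with _ | l
    · refine (d_hom_zero _ _).trans ?_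
      rw [av_even hne, hb]
      exact (hq 0 (by simp)).symm
    · rcases Nat.lt_or_ge l n with hl | hl
      · refine (d_hom_succ n b l hl).trans ?_
        by_cases hev : Even l
        · have := h ⟨l + 1, by omega⟩
          rw [if_neg (by simpa [Nat.even_add_one] using hev)] at this
          rw [av_odd (by simpa [Nat.even_add_one] using hev), av_odd (by
              rw [Nat.even_sub hl.le]; rw [Nat.even_add_one] at hne; tauto)]
          rw [this]; simp
        · have hl0 : l ≠ 0 := by rintro rfl; simp at hev
          have hev' : Even (l + 1) := by simpa [Nat.even_add_one] using hev
          refine Eq.trans ?_ (hq ⟨l + 1, by omega⟩ hev').symm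
          rw [hb, hb, av_even hev']
          simp [hl0, hev, hev']
      · obtain rfl : l = n := by omega
        have hl0 : l ≠ 0 := by rintro rfl; simp at hne
        have hev : ¬ Even l := by simpa [Nat.even_add_one] using hne
        refine (d_hom_last _ _).trans ?_
        refine Eq.trans ?_ (hq ⟨l + 1, by omega⟩ hne).symm
        rw [hb, av_even hne]
        simp [hl0, hev]

end coh

end ZpZp

open ZpZp CategoryTheory in
theorem group_cohomology_zpzp_even
    (p : ℕ) [Fact p.Prime] (hodd : Odd p) (k : ℕ) (hk : 1 ≤ k) :
    Nonempty
      ((groupCohomology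
          (Rep.trivial ℤ (Multiplicative (ZMod p × ZMod p)) ℤ) (2 * k)) ≃+
        (Fin (k + 1) → ZMod p)) := by
  obtain ⟨n, hn⟩ : ∃ n, 2 * k = n + 1 := ⟨2 * k - 1, by omega⟩
  let X := (cplx p ℤ).linearYonedaObj ℤ (T p ℤ)
  let S := X.sc' n (n + 1) (n + 2)
  let i1 : groupCohomology (T p ℤ) (n + 1) ≅ S.homology :=
    groupCohomologyIso (T p ℤ) (n + 1) (res p ℤ) ≪≫
      X.homologyIsoSc' n (n + 1) (n + 2) (by simp) (by simp)
  suffices h : Nonempty (S.homology ≃+ (Fin (k + 1) → ZMod p)) by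
    obtain ⟨h⟩ := h
    rw [hn]
    exact ⟨i1.toLinearEquiv.toAddEquiv.trans h⟩
  have hf : ∀ b : P p ℤ n ⟶ T p ℤ, S.f.hom b = dR p ℤ n ≫ b := by
    intro b; rw [← cplx_d]; rfl
  have hg : ∀ b : P p ℤ (n + 1) ⟶ T p ℤ, S.g.hom b = dR p ℤ (n + 1) ≫ b := by
    intro b; rw [← cplx_d]; rfl
  have hcoc : ∀ φ : P p ℤ (n + 1) ⟶ T p ℤ, dR p ℤ (n + 1) ≫ φ = 0 ↔
      ∀ i : Fin (n + 2), ¬ Even (i : ℕ) → φ.hom (e (n + 1) i) = (0 : ℤ) := by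
    have := cocycle_iff (p := p) k
    rw [hn] at this
    exact this
  let ψ : (P p ℤ (n + 1) ⟶ T p ℤ) →+ (Fin (k + 1) → ZMod p) :=
    { toFun := fun φ j => ((φ.hom (e (n + 1) ⟨2 * j, by omega⟩) : ℤ) : ZMod p)
      map_zero' := by
        ext j
        exact Int.cast_zero
      map_add' := fun φ φ' => by
        ext j
        exact Int.cast_add _ _ }
  have hψ : ∀ φ j, ψ φ j = ((φ.hom (e (n + 1) ⟨2 * j, by omega⟩) : ℤ) : ZMod p) :=
    fun _ _ => rfl
  refine nonempty_homology S (T := Fin (k + 1) → ZMod p)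
    (AddMonoidHom.toIntLinearMap (M := (P p ℤ (n + 1) ⟶ T p ℤ)) ψ) ?_ ?_
  · intro t
    choose z hz using fun j => ZMod.intCast_surjective (t j)
    let φ : P p ℤ (n + 1) ⟶ T p ℤ := lift (n + 1) _ (fun l =>
      if Even (l : ℕ) then z ⟨l / 2, by omega⟩ else (0 : ℤ))
    have hφ : ∀ l : Fin (n + 2), φ.hom (e (n + 1) l) =
      if Even (l : ℕ) then z ⟨l / 2, by omega⟩ else (0 : ℤ) := fun l => lift_e _ _ _ l
    refine ⟨φ, ?_, ?_⟩
    · refine (hg φ).trans ((hcoc φ).2 fun i hi => ?_)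
      rw [hφ, if_neg hi]
    · change ψ φ = t
      ext j
      rw [hψ, hφ, if_pos (by simp), ← hz]
      congr 2
      ext; simp
  · intro φ hφ0
    have h0 := (hcoc φ).1 ((hg φ).symm.trans hφ0)
    have h1 := coboundary_iff n k hn.symm φ
    refine Iff.trans ?_ (h1.symm.trans ?_)
    · change ψ φ = 0 ↔ _
      constructor
      · rintro h ⟨i, hi⟩
        split_ifs with hev
        · have hev' : Even i := hev
          obtain ⟨j, rfl⟩ := hev'.two_dvd
          have h2 := congrFun h ⟨j, by omega⟩
          exact (ZMod.intCast_zmod_eq_zero_iff_dvd _ p).1 ((hψ φ _).symm.trans h2)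
        · exact h0 _ hev
      · intro h
        ext j
        have h2 := h ⟨2 * j, by omega⟩
        rw [if_pos (by simp)] at h2
        exact (hψ φ j).trans ((ZMod.intCast_zmod_eq_zero_iff_dvd _ p).2 h2)
    · exact exists_congr fun b => by rw [← hf b]; rfl
end
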